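/- arXiv:math/0508269 — 2 statements merged into one kernel-verified Lean document; each statement's English description precedes it below -/
import Mathlib

section
/- Let a crossing sequence S (a double occurrence word of length 2n) come from a closed curve in the plane with n transverse double points, by recording the crossings in order along the curve. Then S is evenly intersticed: between the two occurrences of any symbol lies a subword of even length. -/
open Filter Topology

/-- parity of crossings of the segment `[z,w]` with the negative half-axis -/
noncomputable def gE (z w : ℝ × ℝ) : ZMod 2 :=
  if (0 ≤ z.2 ∧ w.2 < 0 ∧ w.1 * z.2 - z.1 * w.2 < 0) ∨
     (0 ≤ w.2 ∧ z.2 < 0 ∧ z.1 * w.2 - w.1 * z.2 < 0) then 1 else 0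

noncomputable def gC (a b c d : ℝ × ℝ) : ZMod 2 := gE a b + gE b c + gE c d + gE d a

lemma gE_comm (z w : ℝ × ℝ) : gE z w = gE w z := by
  unfold gE; congr 1; rw [or_comm]

lemma gC_right {a b c d : ℝ × ℝ} (ha : 0 ≤ a.1) (hb : 0 ≤ b.1) (hc : 0 ≤ c.1) (hd : 0 ≤ d.1) :
    gC a b c d = 0 := by
  have key : ∀ z w : ℝ × ℝ, 0 ≤ z.1 → 0 ≤ w.1 → gE z w = 0 := by
    intro z w hz hw
    unfold gE
    rw [if_neg]
    rintro (⟨h1, h2, h3⟩ | ⟨h1, h2, h3⟩) <;> nlinarith [mul_nonneg hw h1, mul_nonneg hz h1]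
  simp [gC, *]

noncomputable def gh (z : ℝ × ℝ) : ZMod 2 := if 0 ≤ z.2 then 1 else 0

lemma gE_half {α β : ℝ} {z w : ℝ × ℝ} (hz : 0 < α * z.1 + β * z.2) (hw : 0 < α * w.1 + β * w.2) :
    gE z w = if α < 0 then gh z + gh w else 0 := by
  have key : ∀ z w : ℝ × ℝ, 0 < α * z.1 + β * z.2 → 0 < α * w.1 + β * w.2 → 0 ≤ z.2 → w.2 < 0 →
      (w.1 * z.2 - z.1 * w.2 < 0 ↔ α < 0) := by
    intro z w hz hw h1 h2
    have h : 0 < α * (w.1 * z.2 - z.1 * w.2) := by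
      nlinarith [mul_nonneg hw.le h1, mul_pos hz (neg_pos.2 h2)]
    constructor
    · intro h3; by_contra h4; push Not at h4; nlinarith
    · intro h3; by_contra h4; push Not at h4; nlinarith
  have h11 : (1 : ZMod 2) + 1 = 0 := by decide
  unfold gE gh
  by_cases h1 : 0 ≤ z.2 <;> by_cases h2 : 0 ≤ w.2
  · simp [h1, h2, not_lt.2 h1, not_lt.2 h2, h11]
  · have := key z w hz hw h1 (not_le.1 h2)
    simp [h1, h2, not_le.1 h2, this]
  · have := key w z hw hz h2 (not_le.1 h1)
    simp [h1, h2, not_le.1 h1, this]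
  · simp [h1, h2]

lemma gC_half (α β : ℝ) {a b c d : ℝ × ℝ} (ha : 0 < α * a.1 + β * a.2) (hb : 0 < α * b.1 + β * b.2)
    (hc : 0 < α * c.1 + β * c.2) (hd : 0 < α * d.1 + β * d.2) : gC a b c d = 0 := by
  unfold gC
  rw [gE_half ha hb, gE_half hb hc, gE_half hc hd, gE_half hd ha]
  split_ifs
  · generalize gh a = x; generalize gh b = y; generalize gh c = z; generalize gh d = w
    revert x y z w; decide
  · simp

lemma gE_pos {a b : ℝ × ℝ} (h : 0 < a.1 * b.2 - b.1 * a.2) :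
    gE a b = if 0 ≤ a.2 ∧ b.2 < 0 then 1 else 0 := by
  unfold gE
  congr 1
  apply propext
  constructor
  · rintro (h1 | h1)
    · exact ⟨h1.1, h1.2.1⟩
    · linarith [h1.2.2]
  · intro h1; left; exact ⟨h1.1, h1.2, by linarith⟩

lemma alt_false {a1 a2 b1 b2 c1 c2 d1 d2 : ℝ} (h1 : 0 < a1 * b2 - b1 * a2) (h2 : 0 < b1 * c2 - c1 * b2)
    (h3 : 0 < c1 * d2 - d1 * c2) (h4 : 0 < d1 * a2 - a1 * d2)
    (ha : 0 ≤ a2) (hb : b2 < 0) (hc : 0 ≤ c2) (hd : d2 < 0) : False := by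
  have e1 : b2 * (a1 * c2 - c1 * a2) = a2 * (b1 * c2 - c1 * b2) + c2 * (a1 * b2 - b1 * a2) := by ring
  have e2 : d2 * (c1 * a2 - a1 * c2) = c2 * (d1 * a2 - a1 * d2) + a2 * (c1 * d2 - d1 * c2) := by ring
  have p1 := mul_nonneg ha h2.le
  have p2 := mul_nonneg hc h1.le
  have p3 := mul_nonneg hc h4.le
  have p4 := mul_nonneg ha h3.le
  have q1 : a1 * c2 - c1 * a2 ≤ 0 := by by_contra h; push Not at h; nlinarith
  have q2 : c1 * a2 - a1 * c2 ≤ 0 := by by_contra h; push Not at h; nlinarith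
  have q3 : a1 * c2 - c1 * a2 = 0 := by linarith
  rw [q3] at e1
  have r1 : a2 * (b1 * c2 - c1 * b2) = 0 := by linarith
  have r2 : c2 * (a1 * b2 - b1 * a2) = 0 := by linarith
  have r3 : a2 = 0 := by rcases mul_eq_zero.1 r1 with h | h; exact h; linarith
  have r4 : c2 = 0 := by rcases mul_eq_zero.1 r2 with h | h; exact h; linarith
  subst r3; subst r4
  have : 0 < c1 := by by_contra h; push Not at h; nlinarith
  nlinarith

lemma up_false {a1 a2 b1 b2 c1 c2 d1 d2 : ℝ} (h1 : 0 < a1 * b2 - b1 * a2) (h2 : 0 < b1 * c2 - c1 * b2)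
    (h3 : 0 < c1 * d2 - d1 * c2) (h4 : 0 < d1 * a2 - a1 * d2)
    (ha : 0 ≤ a2) (hb : 0 ≤ b2) (hc : 0 ≤ c2) (hd : 0 ≤ d2) : False := by
  have e1 : b2 * (a1 * c2 - c1 * a2) = a2 * (b1 * c2 - c1 * b2) + c2 * (a1 * b2 - b1 * a2) := by ring
  have e2 : d2 * (c1 * a2 - a1 * c2) = c2 * (d1 * a2 - a1 * d2) + a2 * (c1 * d2 - d1 * c2) := by ring
  have p1 := mul_nonneg ha h2.le
  have p2 := mul_nonneg hc h1.le
  have p3 := mul_nonneg hc h4.le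
  have p4 := mul_nonneg ha h3.le
  rcases lt_trichotomy (a1 * c2 - c1 * a2) 0 with h | h | h
  · have t : a2 * (b1 * c2 - c1 * b2) = 0 := by nlinarith
    have t' : c2 * (a1 * b2 - b1 * a2) = 0 := by nlinarith
    have r3 : a2 = 0 := by rcases mul_eq_zero.1 t with h | h; exact h; linarith
    have r4 : c2 = 0 := by rcases mul_eq_zero.1 t' with h | h; exact h; linarith
    subst r3; subst r4; linarith
  · rw [h] at e1
    have t : a2 * (b1 * c2 - c1 * b2) = 0 := by nlinarith
    have t' : c2 * (a1 * b2 - b1 * a2) = 0 := by nlinarith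
    have r3 : a2 = 0 := by rcases mul_eq_zero.1 t with h | h; exact h; linarith
    have r4 : c2 = 0 := by rcases mul_eq_zero.1 t' with h | h; exact h; linarith
    subst r3; subst r4
    have : 0 < a1 := by by_contra h; push Not at h; nlinarith
    nlinarith
  · have t : a2 * (c1 * d2 - d1 * c2) = 0 := by nlinarith
    have t' : c2 * (d1 * a2 - a1 * d2) = 0 := by nlinarith
    have r3 : a2 = 0 := by rcases mul_eq_zero.1 t with h | h; exact h; linarith
    have r4 : c2 = 0 := by rcases mul_eq_zero.1 t' with h | h; exact h; linarith
    subst r3; subst r4; linarith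

lemma gC_pos {a b c d : ℝ × ℝ} (h1 : 0 < a.1 * b.2 - b.1 * a.2) (h2 : 0 < b.1 * c.2 - c.1 * b.2)
    (h3 : 0 < c.1 * d.2 - d.1 * c.2) (h4 : 0 < d.1 * a.2 - a.1 * d.2) : gC a b c d = 1 := by
  unfold gC
  rw [gE_pos h1, gE_pos h2, gE_pos h3, gE_pos h4]
  by_cases ha : 0 ≤ a.2 <;> by_cases hb : 0 ≤ b.2 <;> by_cases hc : 0 ≤ c.2 <;>
    by_cases hd : 0 ≤ d.2 <;>
    first
    | (simp [ha, hb, hc, hd, not_lt.2, not_le.1]; done)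
    | (exfalso; exact up_false h1 h2 h3 h4 ha hb hc hd)
    | (exfalso; exact alt_false h1 h2 h3 h4 ha (not_le.1 hb) hc (not_le.1 hd))
    | (exfalso; exact alt_false h2 h3 h4 h1 hb (not_le.1 hc) hd (not_le.1 ha))
    | (exfalso
       push Not at ha hb hc hd
       refine up_false (a1 := -a.1) (a2 := -a.2) (b1 := -b.1) (b2 := -b.2) (c1 := -c.1) (c2 := -c.2)
        (d1 := -d.1) (d2 := -d.2) ?_ ?_ ?_ ?_ ?_ ?_ ?_ ?_ <;> linarith)

lemma gC_neg {a b c d : ℝ × ℝ} (h1 : a.1 * b.2 - b.1 * a.2 < 0) (h2 : b.1 * c.2 - c.1 * b.2 < 0)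
    (h3 : c.1 * d.2 - d.1 * c.2 < 0) (h4 : d.1 * a.2 - a.1 * d.2 < 0) : gC a b c d = 1 := by
  have : gC d c b a = 1 := gC_pos (by linarith) (by linarith) (by linarith) (by linarith)
  rw [← this]; unfold gC
  rw [gE_comm d c, gE_comm c b, gE_comm b a, gE_comm a d]; ring

lemma gC_mul (κ : ℝ) {a b c d : ℝ × ℝ} (h1 : 0 < κ * (a.1 * b.2 - b.1 * a.2))
    (h2 : 0 < κ * (b.1 * c.2 - c.1 * b.2))
    (h3 : 0 < κ * (c.1 * d.2 - d.1 * c.2)) (h4 : 0 < κ * (d.1 * a.2 - a.1 * d.2)) :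
    gC a b c d = 1 := by
  rcases lt_trichotomy κ 0 with h | h | h
  · apply gC_neg <;> by_contra h' <;> push Not at h' <;> nlinarith
  · simp [h] at h1
  · exact gC_pos (pos_of_mul_pos_right h1 h.le) (pos_of_mul_pos_right h2 h.le)
      (pos_of_mul_pos_right h3 h.le) (pos_of_mul_pos_right h4 h.le)

lemma sum_gC {N M : ℕ} (G : ℕ → ℕ → ℝ × ℝ) (h1 : ∀ l, G N l = G 0 l) (h2 : ∀ k, G k M = G k 0) :
    ∑ k ∈ Finset.range N, ∑ l ∈ Finset.range M,
      gC (G k l) (G (k+1) l) (G (k+1) (l+1)) (G k (l+1)) = 0 := by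
  have e : ∀ k l, gC (G k l) (G (k+1) l) (G (k+1) (l+1)) (G k (l+1)) =
      (gE (G k (l+1)) (G (k+1) (l+1)) - gE (G k l) (G (k+1) l)) +
      (gE (G (k+1) l) (G (k+1) (l+1)) - gE (G k l) (G k (l+1))) := by
    intro k l
    unfold gC
    rw [gE_comm (G (k+1) (l+1)) (G k (l+1)), gE_comm (G k (l+1)) (G k l)]
    simp only [CharTwo.sub_eq_add]; ring
  simp only [e, Finset.sum_add_distrib]
  rw [Finset.sum_comm (f := fun k l => gE (G (k+1) l) (G (k+1) (l+1)) - gE (G k l) (G k (l+1)))]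
  have s1 : ∀ k, ∑ l ∈ Finset.range M, (gE (G k (l+1)) (G (k+1) (l+1)) - gE (G k l) (G (k+1) l)) = 0 := by
    intro k
    rw [Finset.sum_range_sub (fun l => gE (G k l) (G (k+1) l))]
    simp [h2]
  have s2 : ∀ l, ∑ k ∈ Finset.range N, (gE (G (k+1) l) (G (k+1) (l+1)) - gE (G k l) (G k (l+1))) = 0 := by
    intro l
    rw [Finset.sum_range_sub (fun k => gE (G k l) (G k (l+1)))]
    simp [h1]
  simp [s1, s2]

lemma grid (a b : ℝ) (hab : a < b) (P : Finset ℝ) (hP : ∀ p ∈ P, a < p ∧ p < b) :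
    ∀ᶠ N : ℕ in atTop, ∃ x : ℕ → ℝ, x 0 = a ∧ x N = b ∧ (∀ k ≤ N, a ≤ x k ∧ x k ≤ b) ∧
      (∀ k < N, x k < x (k+1) ∧ x (k+1) - x k ≤ 2 * ((b - a) / N)) ∧
      ∀ k ≤ N, ∀ p ∈ P, (b - a) / N / 8 ≤ |x k - p| := by
  have lim : Tendsto (fun N : ℕ => (b - a) / N) atTop (𝓝 0) :=
    tendsto_const_div_atTop_nhds_zero_nat _
  have ev : ∀ r : ℝ, 0 < r → ∀ᶠ N : ℕ in atTop, (b - a) / N < r := fun r hr =>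
    lim.eventually (gt_mem_nhds hr)
  have e1 : ∀ᶠ N : ℕ in atTop, ∀ p ∈ P, (b - a) / N < p - a ∧ (b - a) / N < b - p := by
    rw [Filter.eventually_all_finset]
    intro p hp
    exact (ev _ (by linarith [hP p hp])).and (ev _ (by linarith [hP p hp]))
  have e2 : ∀ᶠ N : ℕ in atTop, ∀ p ∈ P, ∀ q ∈ P, p ≠ q → (b - a) / N < |p - q| := by
    rw [Filter.eventually_all_finset]
    intro p hp
    rw [Filter.eventually_all_finset]
    intro q hq
    by_cases h : p = q
    · simp [h]
    · filter_upwards [ev |p - q| (abs_pos.2 (sub_ne_zero.2 h))] with N hN _ using hN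
  filter_upwards [e1, e2, eventually_gt_atTop 0] with N h1 h2 hN
  set h := (b - a) / N with hh
  have hNr : (0:ℝ) < N := by exact_mod_cast hN
  have hpos : 0 < h := div_pos (by linarith) hNr
  have hNh : N * h = b - a := by rw [hh]; field_simp
  classical
  have hx : ∀ k : ℕ, ∃ x : ℝ, (x = a + k * h ∨ x = a + k * h + h / 4) ∧ (∀ p ∈ P, h / 8 ≤ |x - p|) ∧
      ((k = 0 ∨ k = N) → x = a + k * h) := by
    intro k
    by_cases hc : ∀ p ∈ P, h / 8 ≤ |a + k * h - p|
    · exact ⟨_, Or.inl rfl, hc, fun _ => rfl⟩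
    · push Not at hc
      obtain ⟨p, hp, hlt⟩ := hc
      rw [abs_lt] at hlt
      refine ⟨_, Or.inr rfl, ?_, ?_⟩
      · intro q hq
        by_cases hpq : p = q
        · subst hpq
          rw [le_abs]; left; linarith
        · have := h2 p hp q hq hpq
          rcases abs_cases (p - q) with h' | h' <;> rw [le_abs]
          · left; linarith
          · right; linarith
      · rintro (h0 | h0)
        · subst h0
          have := h1 p hp
          simp at hlt; linarith
        · subst h0
          have := h1 p hp
          rw [hNh] at hlt
          linarith
  choose x hx1 hx2 hx3 using hx
  refine ⟨x, ?_, ?_, ?_, ?_, fun k _ => hx2 k⟩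
  · rw [hx3 0 (Or.inl rfl)]; simp
  · rw [hx3 N (Or.inr rfl), hNh]; ring
  · intro k hk
    rcases hk.lt_or_eq with hk | hk
    · have : ((k:ℝ) + 1) * h ≤ N * h := by
        apply mul_le_mul_of_nonneg_right _ hpos.le
        exact_mod_cast hk
      have : 0 ≤ k * h := by positivity
      rcases hx1 k with h' | h' <;> rw [h'] <;> constructor <;> linarith
    · subst hk
      rw [hx3 k (Or.inr rfl), hNh]; constructor <;> linarith
  · intro k hk
    have := hx1 (k+1)
    push_cast at this
    rcases hx1 k with h' | h' <;> rcases this with h'' | h'' <;> rw [h', h''] <;> constructor <;>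
      linarith

lemma sum_ind {N : ℕ} (x : ℕ → ℝ) (hx : ∀ k < N, x k < x (k+1)) (p : ℝ) (h0 : x 0 < p) (h1 : p < x N) :
    ∑ k ∈ Finset.range N, (if x k < p ∧ p ≤ x (k+1) then (1 : ZMod 2) else 0) = 1 := by
  have : ∀ k ∈ Finset.range N, (if x k < p ∧ p ≤ x (k+1) then (1 : ZMod 2) else 0) =
    (if p ≤ x (k+1) then 1 else 0) - (if p ≤ x k then 1 else 0) := by
    intro k hk
    have := hx k (Finset.mem_range.1 hk)
    by_cases h2 : p ≤ x k
    · simp [h2, not_lt.2 h2, h2.trans this.le]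
    · simp [h2, not_le.1 h2]
  rw [Finset.sum_congr rfl this, Finset.sum_range_sub (fun k => if p ≤ x k then (1 : ZMod 2) else 0)]
  simp [h1.le, not_le.2 h0]

def gF (f g : ℝ → ℝ) (s u : ℝ) : ℝ × ℝ := (f s - f u, g s - g u)

/-- the cells inside `U` have the expected parity -/
def GoodN (f g : ℝ → ℝ) (a b c K : ℝ) (Z : Finset (ℝ × ℝ)) (U : Set (ℝ × ℝ)) : Prop :=
  ∀ δ s s' u u' : ℝ, 0 < δ → s < s' → u < u' → s' - s ≤ K * δ → u' - u ≤ K * δ →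
    a ≤ s → s' ≤ b → b ≤ u → u' ≤ c →
    Set.Icc s s' ×ˢ Set.Icc u u' ⊆ U →
    (∀ z ∈ Z, δ ≤ |s - z.1| ∧ δ ≤ |s' - z.1| ∧ δ ≤ |u - z.2| ∧ δ ≤ |u' - z.2|) →
    gC (gF f g s u) (gF f g s' u) (gF f g s' u') (gF f g s u') =
      ∑ z ∈ Z, (if s < z.1 ∧ z.1 ≤ s' then (1 : ZMod 2) else 0) *
        (if u < z.2 ∧ z.2 ≤ u' then 1 else 0)

lemma verts {s s' u u' : ℝ} {U : Set (ℝ × ℝ)} (hs : s < s') (hu : u < u')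
    (h : Set.Icc s s' ×ˢ Set.Icc u u' ⊆ U) : (s, u) ∈ U ∧ (s', u) ∈ U ∧ (s', u') ∈ U ∧ (s, u') ∈ U := by
  refine ⟨h ?_, h ?_, h ?_, h ?_⟩ <;> simp [hs.le, hu.le]

lemma sum_zero_of {s s' u u' : ℝ} {U : Set (ℝ × ℝ)} {Z : Finset (ℝ × ℝ)}
    (h : Set.Icc s s' ×ˢ Set.Icc u u' ⊆ U) (hZ : ∀ z ∈ Z, z ∉ U) :
    ∑ z ∈ Z, (if s < z.1 ∧ z.1 ≤ s' then (1 : ZMod 2) else 0) *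
        (if u < z.2 ∧ z.2 ≤ u' then 1 else 0) = 0 := by
  apply Finset.sum_eq_zero
  intro z hz
  by_cases h1 : s < z.1 ∧ z.1 ≤ s'
  · by_cases h2 : u < z.2 ∧ z.2 ≤ u'
    · exact absurd (h (Set.mem_prod.2 ⟨⟨h1.1.le, h1.2⟩, ⟨h2.1.le, h2.2⟩⟩)) (hZ z hz)
    · simp [h2]
  · simp [h1]

lemma nhds_compl (Z : Finset (ℝ × ℝ)) (z : ℝ × ℝ) (hz : z ∉ Z) : ∀ᶠ y in 𝓝 z, y ∉ Z := by
  have : (Z : Set (ℝ × ℝ))ᶜ ∈ 𝓝 z := Z.finite_toSet.isClosed.isOpen_compl.mem_nhds (by simpa using hz)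
  filter_upwards [this] with y hy
  simpa using hy

lemma good_nonzero {f g : ℝ → ℝ} (hf : Continuous f) (hg : Continuous g) (a b c K : ℝ)
    (Z : Finset (ℝ × ℝ)) (z : ℝ × ℝ) (hz : z ∉ Z) (h0 : ¬ (f z.1 = f z.2 ∧ g z.1 = g z.2)) :
    ∃ U ∈ 𝓝 z, GoodN f g a b c K Z U := by
  set α := f z.1 - f z.2 with hα
  set β := g z.1 - g z.2 with hβ
  have hcont : Continuous fun y : ℝ × ℝ => α * (f y.1 - f y.2) + β * (g y.1 - g y.2) := by fun_prop
  have hp : 0 < α * (f z.1 - f z.2) + β * (g z.1 - g z.2) := by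
    rw [← hα, ← hβ]
    by_cases h : α = 0
    · have : β ≠ 0 := fun h' => h0 ⟨by linarith, by linarith⟩
      have := mul_self_pos.2 this
      nlinarith [mul_self_nonneg α]
    · have := mul_self_pos.2 h
      nlinarith [mul_self_nonneg β]
  have ev := (hcont.tendsto z).eventually (lt_mem_nhds hp)
  refine ⟨_, ev.and (nhds_compl Z z hz), ?_⟩
  intro δ s s' u u' _ hs hu _ _ _ _ _ _ hU _
  rw [sum_zero_of hU (fun y hy hy' => hy'.2 hy)]
  obtain ⟨v1, v2, v3, v4⟩ := verts hs hu hU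
  exact gC_half α β v1.1 v2.1 v3.1 v4.1

lemma good_corner {f g : ℝ → ℝ} (a b c K : ℝ)
    (Z : Finset (ℝ × ℝ)) (z : ℝ × ℝ) (hz : z ∉ Z)
    (h1 : ∀ᶠ s in 𝓝 z.1, a ≤ s → s ≤ b → f z.1 ≤ f s)
    (h2 : ∀ᶠ u in 𝓝 z.2, b ≤ u → u ≤ c → f u ≤ f z.1) :
    ∃ U ∈ 𝓝 z, GoodN f g a b c K Z U := by
  have ev : ∀ᶠ y : ℝ × ℝ in 𝓝 z, (a ≤ y.1 → y.1 ≤ b → f z.1 ≤ f y.1) ∧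
      (b ≤ y.2 → y.2 ≤ c → f y.2 ≤ f z.1) :=
    (continuous_fst.continuousAt.eventually h1).and (continuous_snd.continuousAt.eventually h2)
  refine ⟨_, ev.and (nhds_compl Z z hz), ?_⟩
  intro δ s s' u u' _ hs hu _ _ has hsb hbu huc hU _
  rw [sum_zero_of hU (fun y hy hy' => hy'.2 hy)]
  obtain ⟨v1, v2, v3, v4⟩ := verts hs hu hU
  have p1 := v1.1.1 has (hs.le.trans hsb)
  have p2 := v3.1.1 (has.trans hs.le) hsb
  have p3 := v1.1.2 hbu (hu.le.trans huc)
  have p4 := v3.1.2 (hbu.trans hu.le) huc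
  simp only at p1 p2 p3 p4
  apply gC_right <;> simp only [gF] <;> linarith

lemma deriv_est {φ : ℝ → ℝ} {x m ε : ℝ} (h : HasDerivAt φ m x) (hε : 0 < ε) :
    ∀ᶠ y in 𝓝 x, |φ y - φ x - m * (y - x)| ≤ ε * |y - x| := by
  have := (hasDerivAt_iff_isLittleO.1 h).def hε
  filter_upwards [this] with y hy
  simpa [mul_comm] using hy

lemma side_cases {s s' p δ K : ℝ} (hs : s < s') (hg : s' - s ≤ K * δ) (h1 : δ ≤ |s - p|)
    (h2 : δ ≤ |s' - p|) :
    (δ ≤ s - p ∧ δ ≤ s' - p) ∨ (δ ≤ p - s ∧ δ ≤ p - s') ∨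
    (δ ≤ p - s ∧ δ ≤ s' - p ∧ p - s ≤ K * δ ∧ s' - p ≤ K * δ) := by
  rw [le_abs] at h1 h2
  by_cases h : 0 < δ
  · rcases h1 with h1 | h1 <;> rcases h2 with h2 | h2
    · left; constructor <;> linarith
    · linarith
    · right; right; refine ⟨?_, ?_, ?_, ?_⟩ <;> linarith
    · right; left; constructor <;> linarith
  · rcases le_total s p with h3 | h3
    · rcases le_total s' p with h4 | h4
      · right; left; constructor <;> linarith
      · right; right; refine ⟨?_, ?_, ?_, ?_⟩ <;> linarith
    · left; constructor <;> linarith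

lemma vfact {Φ Ψ S W ε K δ : ℝ} (hεp : 0 < ε) (hε1 : ε ≤ 1 / 16) (eδ : ε * (K * δ) = δ / 16)
    (hS : δ ≤ |S|) (hW : δ ≤ |W|)
    (h : |Φ - S| ≤ ε * (|S| + |W|) ∧ |Ψ - W| ≤ ε * (|S| + |W|)) :
    |Φ - S| ≤ (|S| + |W|) / 16 ∧ |Ψ - W| ≤ (|S| + |W|) / 16 ∧
    (|S| ≤ K * δ → |Ψ - W| ≤ |W| / 8) ∧ (|W| ≤ K * δ → |Φ - S| ≤ |S| / 8) := by
  have a1 : ε * |S| ≤ 1 / 16 * |S| := mul_le_mul_of_nonneg_right hε1 (abs_nonneg _)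
  have a2 : ε * |W| ≤ 1 / 16 * |W| := mul_le_mul_of_nonneg_right hε1 (abs_nonneg _)
  rw [mul_add] at h
  refine ⟨by linarith [h.1], by linarith [h.2], fun h' => ?_, fun h' => ?_⟩
  · have := mul_le_mul_of_nonneg_left h' hεp.le
    linarith [h.2]
  · have := mul_le_mul_of_nonneg_left h' hεp.le
    linarith [h.1]

set_option maxHeartbeats 2000000 in
lemma good_zero {f g : ℝ → ℝ} (a b c K : ℝ) (hK : 1 ≤ K)
    (Z : Finset (ℝ × ℝ)) (z : ℝ × ℝ) (hz : z ∈ Z) {f1 f2 g1 g2 : ℝ}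
    (hf1 : HasDerivAt f f1 z.1) (hf2 : HasDerivAt f f2 z.2)
    (hg1 : HasDerivAt g g1 z.1) (hg2 : HasDerivAt g g2 z.2)
    (hfz : f z.1 = f z.2) (hgz : g z.1 = g z.2)
    (hJ : f1 * g2 - g1 * f2 ≠ 0) :
    ∃ U ∈ 𝓝 z, GoodN f g a b c K Z U := by
  set J := f1 * g2 - g1 * f2 with hJdef
  obtain ⟨φ, hφ⟩ : ∃ φ : ℝ → ℝ, φ = fun x => f x * (g2 / J) - g x * (f2 / J) := ⟨_, rfl⟩
  obtain ⟨ψ, hψ⟩ : ∃ ψ : ℝ → ℝ, ψ = fun x => f x * (g1 / J) - g x * (f1 / J) := ⟨_, rfl⟩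
  have d1 : HasDerivAt φ 1 z.1 := by
    rw [hφ]
    refine ((hf1.mul_const (g2 / J)).sub (hg1.mul_const (f2 / J))).congr_deriv ?_
    field_simp; rw [hJdef]
  have d2 : HasDerivAt φ 0 z.2 := by
    rw [hφ]
    refine ((hf2.mul_const (g2 / J)).sub (hg2.mul_const (f2 / J))).congr_deriv ?_
    field_simp; ring
  have d3 : HasDerivAt ψ 0 z.1 := by
    rw [hψ]
    refine ((hf1.mul_const (g1 / J)).sub (hg1.mul_const (f1 / J))).congr_deriv ?_
    field_simp; ring
  have d4 : HasDerivAt ψ (-1) z.2 := by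
    rw [hψ]
    refine ((hf2.mul_const (g1 / J)).sub (hg2.mul_const (f1 / J))).congr_deriv ?_
    field_simp; rw [hJdef]; ring
  have hφz : φ z.1 = φ z.2 := by rw [hφ]; simp only [hfz, hgz]
  have hψz : ψ z.1 = ψ z.2 := by rw [hψ]; simp only [hfz, hgz]
  set ε := 1 / (16 * K) with hε
  have hεp : 0 < ε := by positivity
  have hε1 : ε ≤ 1 / 16 := by
    rw [hε]; apply one_div_le_one_div_of_le <;> linarith
  have hεK : ε * K = 1 / 16 := by rw [hε]; field_simp
  have ev : ∀ᶠ y : ℝ × ℝ in 𝓝 z,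
      (|φ y.1 - φ y.2 - (y.1 - z.1)| ≤ ε * (|y.1 - z.1| + |y.2 - z.2|) ∧
      |ψ y.1 - ψ y.2 - (y.2 - z.2)| ≤ ε * (|y.1 - z.1| + |y.2 - z.2|)) ∧
      y ∉ Z.erase z := by
    have t1 := (continuous_fst.tendsto z).eventually (deriv_est d1 hεp)
    have t2 := (continuous_snd.tendsto z).eventually (deriv_est d2 hεp)
    have t3 := (continuous_fst.tendsto z).eventually (deriv_est d3 hεp)
    have t4 := (continuous_snd.tendsto z).eventually (deriv_est d4 hεp)
    filter_upwards [t1, t2, t3, t4, nhds_compl (Z.erase z) z (by simp)] with y h1 h2 h3 h4 h5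
    refine ⟨⟨?_, ?_⟩, h5⟩
    · rw [abs_le] at *
      constructor <;> linarith
    · rw [abs_le] at *
      constructor <;> linarith
  refine ⟨_, ev, ?_⟩
  intro δ s s' u u' hδ hs hu hgs hgu _ _ _ _ hU hZ
  have hsum : ∑ z ∈ Z, (if s < z.1 ∧ z.1 ≤ s' then (1 : ZMod 2) else 0) *
        (if u < z.2 ∧ z.2 ≤ u' then 1 else 0) = (if s < z.1 ∧ z.1 ≤ s' then (1 : ZMod 2) else 0) *
        (if u < z.2 ∧ z.2 ≤ u' then 1 else 0) := by
    rw [← Finset.add_sum_erase Z _ hz, sum_zero_of hU (fun y hy hy' => hy'.2 hy), add_zero]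
  rw [hsum]
  obtain ⟨v1, v2, v3, v4⟩ := verts hs hu hU
  replace v1 := v1.1
  replace v2 := v2.1
  replace v3 := v3.1
  replace v4 := v4.1
  simp only at v1 v2 v3 v4
  obtain ⟨k1, k2, k3, k4⟩ := hZ z hz
  have eδ : ε * (K * δ) = δ / 16 := by rw [← mul_assoc, hεK]; ring
  replace v1 := vfact hεp hε1 eδ k1 k3 v1
  replace v2 := vfact hεp hε1 eδ k2 k3 v2
  replace v3 := vfact hεp hε1 eδ k2 k4 v3
  replace v4 := vfact hεp hε1 eδ k1 k4 v4
  -- half plane test in the (φ, ψ) coordinates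
  have half : ∀ A B : ℝ, 0 < A * (φ s - φ u) + B * (ψ s - ψ u) →
      0 < A * (φ s' - φ u) + B * (ψ s' - ψ u) → 0 < A * (φ s' - φ u') + B * (ψ s' - ψ u') →
      0 < A * (φ s - φ u') + B * (ψ s - ψ u') →
      gC (gF f g s u) (gF f g s' u) (gF f g s' u') (gF f g s u') = 0 := by
    intro A B h1 h2 h3 h4
    have e : ∀ x y : ℝ, A * (φ x - φ y) + B * (ψ x - ψ y) =
        (A * (g2 / J) + B * (g1 / J)) * (gF f g x y).1 + (-A * (f2 / J) - B * (f1 / J)) * (gF f g x y).2 := by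
      intro x y; simp only [hφ, hψ, gF]; ring
    rw [e] at h1 h2 h3 h4
    exact gC_half _ _ h1 h2 h3 h4
  have cross : ∀ x y x' y' : ℝ, (φ x - φ y) * (ψ x' - ψ y') - (φ x' - φ y') * (ψ x - ψ y) =
      (-1 / J) * ((gF f g x y).1 * (gF f g x' y').2 - (gF f g x' y').1 * (gF f g x y).2) := by
    intro x y x' y'
    have e : -1 / J = (g1 * f2 - f1 * g2) / J ^ 2 := by
      field_simp; rw [hJdef]; ring
    rw [e]
    simp only [hφ, hψ, gF]; field_simp; ring
  rcases side_cases hs hgs k1 k2 with ⟨a1, a2⟩ | ⟨a1, a2⟩ | ⟨a1, a2, a3, a4⟩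
  · have as := abs_of_pos (hδ.trans_le a1)
    have as' := abs_of_pos (hδ.trans_le a2)
    rw [if_neg (by intro h; linarith [h.1]), zero_mul]
    rw [as] at v1 v4
    rw [as'] at v2 v3
    rcases side_cases hu hgu k3 k4 with ⟨b1, b2⟩ | ⟨b1, b2⟩ | ⟨b1, b2, b3, b4⟩
    · rw [abs_of_pos (hδ.trans_le b1)] at v1 v2
      rw [abs_of_pos (hδ.trans_le b2)] at v3 v4
      simp only [abs_le (a := φ _ - φ _ - _), abs_le (a := ψ _ - ψ _ - _)] at v1 v2 v3 v4
      apply half 1 1 <;> clear half cross <;> linarith [v1.1, v1.2.1, v2.1, v2.2.1, v3.1, v3.2.1, v4.1, v4.2.1]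
    · have bu := abs_of_pos (hδ.trans_le b1)
      have bu' := abs_of_pos (hδ.trans_le b2)
      rw [abs_sub_comm] at bu bu'
      rw [bu] at v1 v2
      rw [bu'] at v3 v4
      simp only [abs_le (a := φ _ - φ _ - _), abs_le (a := ψ _ - ψ _ - _)] at v1 v2 v3 v4
      apply half 1 (-1) <;> clear half cross <;> linarith [v1.1, v1.2.1, v2.1, v2.2.1, v3.1, v3.2.1, v4.1, v4.2.1]
    · have bu := abs_of_pos (hδ.trans_le b1)
      rw [abs_sub_comm] at bu
      rw [bu] at v1 v2
      rw [abs_of_pos (hδ.trans_le b2)] at v3 v4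
      simp only [abs_le (a := φ _ - φ _ - _), abs_le (a := ψ _ - ψ _ - _)] at v1 v2 v3 v4
      obtain ⟨_, _, _, w1⟩ := v1
      obtain ⟨_, _, _, w2⟩ := v2
      obtain ⟨_, _, _, w3⟩ := v3
      obtain ⟨_, _, _, w4⟩ := v4
      replace w1 := w1 b3
      replace w2 := w2 b3
      replace w3 := w3 b4
      replace w4 := w4 b4
      apply half 1 0 <;> linarith [w1.1, w1.2, w2.1, w2.2, w3.1, w3.2, w4.1, w4.2]
  · have as := abs_of_pos (hδ.trans_le a1)
    have as' := abs_of_pos (hδ.trans_le a2)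
    rw [if_neg (by intro h; linarith [h.2]), zero_mul]
    rw [abs_sub_comm] at as as'
    rw [as] at v1 v4
    rw [as'] at v2 v3
    rcases side_cases hu hgu k3 k4 with ⟨b1, b2⟩ | ⟨b1, b2⟩ | ⟨b1, b2, b3, b4⟩
    · rw [abs_of_pos (hδ.trans_le b1)] at v1 v2
      rw [abs_of_pos (hδ.trans_le b2)] at v3 v4
      simp only [abs_le (a := φ _ - φ _ - _), abs_le (a := ψ _ - ψ _ - _)] at v1 v2 v3 v4
      apply half (-1) 1 <;> clear half cross <;> linarith [v1.1, v1.2.1, v2.1, v2.2.1, v3.1, v3.2.1, v4.1, v4.2.1]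
    · have bu := abs_of_pos (hδ.trans_le b1)
      have bu' := abs_of_pos (hδ.trans_le b2)
      rw [abs_sub_comm] at bu bu'
      rw [bu] at v1 v2
      rw [bu'] at v3 v4
      simp only [abs_le (a := φ _ - φ _ - _), abs_le (a := ψ _ - ψ _ - _)] at v1 v2 v3 v4
      apply half (-1) (-1) <;> clear half cross <;> linarith [v1.1, v1.2.1, v2.1, v2.2.1, v3.1, v3.2.1, v4.1, v4.2.1]
    · have bu := abs_of_pos (hδ.trans_le b1)
      rw [abs_sub_comm] at bu
      rw [bu] at v1 v2
      rw [abs_of_pos (hδ.trans_le b2)] at v3 v4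
      simp only [abs_le (a := φ _ - φ _ - _), abs_le (a := ψ _ - ψ _ - _)] at v1 v2 v3 v4
      obtain ⟨_, _, _, w1⟩ := v1
      obtain ⟨_, _, _, w2⟩ := v2
      obtain ⟨_, _, _, w3⟩ := v3
      obtain ⟨_, _, _, w4⟩ := v4
      replace w1 := w1 b3
      replace w2 := w2 b3
      replace w3 := w3 b4
      replace w4 := w4 b4
      apply half (-1) 0 <;> linarith [w1.1, w1.2, w2.1, w2.2, w3.1, w3.2, w4.1, w4.2]
  · have as := abs_of_pos (hδ.trans_le a1)
    rw [abs_sub_comm] at as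
    rw [as] at v1 v4
    rw [abs_of_pos (hδ.trans_le a2)] at v2 v3
    rcases side_cases hu hgu k3 k4 with ⟨b1, b2⟩ | ⟨b1, b2⟩ | ⟨b1, b2, b3, b4⟩
    · rw [abs_of_pos (hδ.trans_le b1)] at v1 v2
      rw [abs_of_pos (hδ.trans_le b2)] at v3 v4
      simp only [abs_le (a := φ _ - φ _ - _), abs_le (a := ψ _ - ψ _ - _)] at v1 v2 v3 v4
      rw [if_neg (c := u < z.2 ∧ _) (by intro h; linarith [h.1]), mul_zero]
      obtain ⟨_, _, w1, _⟩ := v1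
      obtain ⟨_, _, w2, _⟩ := v2
      obtain ⟨_, _, w3, _⟩ := v3
      obtain ⟨_, _, w4, _⟩ := v4
      replace w1 := w1 a3
      replace w2 := w2 a4
      replace w3 := w3 a4
      replace w4 := w4 a3
      apply half 0 1 <;> linarith [w1.1, w1.2, w2.1, w2.2, w3.1, w3.2, w4.1, w4.2]
    · have bu := abs_of_pos (hδ.trans_le b1)
      have bu' := abs_of_pos (hδ.trans_le b2)
      rw [abs_sub_comm] at bu bu'
      rw [bu] at v1 v2
      rw [bu'] at v3 v4
      simp only [abs_le (a := φ _ - φ _ - _), abs_le (a := ψ _ - ψ _ - _)] at v1 v2 v3 v4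
      rw [if_neg (c := u < z.2 ∧ _) (by intro h; linarith [h.2]), mul_zero]
      obtain ⟨_, _, w1, _⟩ := v1
      obtain ⟨_, _, w2, _⟩ := v2
      obtain ⟨_, _, w3, _⟩ := v3
      obtain ⟨_, _, w4, _⟩ := v4
      replace w1 := w1 a3
      replace w2 := w2 a4
      replace w3 := w3 a4
      replace w4 := w4 a3
      apply half 0 (-1) <;> linarith [w1.1, w1.2, w2.1, w2.2, w3.1, w3.2, w4.1, w4.2]
    · have bu := abs_of_pos (hδ.trans_le b1)
      rw [abs_sub_comm] at bu
      rw [bu] at v1 v2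
      rw [abs_of_pos (hδ.trans_le b2)] at v3 v4
      simp only [abs_le (a := φ _ - φ _ - _), abs_le (a := ψ _ - ψ _ - _)] at v1 v2 v3 v4
      rw [if_pos ⟨by linarith, by linarith⟩, if_pos ⟨by linarith, by linarith⟩, mul_one]
      have x1 : φ s - φ u < 0 := by linarith [(v1.2.2.2 b3).1, (v1.2.2.2 b3).2]
      have y1 : ψ s - ψ u < 0 := by linarith [(v1.2.2.1 a3).1, (v1.2.2.1 a3).2]
      have x2 : 0 < φ s' - φ u := by linarith [(v2.2.2.2 b3).1, (v2.2.2.2 b3).2]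
      have y2 : ψ s' - ψ u < 0 := by linarith [(v2.2.2.1 a4).1, (v2.2.2.1 a4).2]
      have x3 : 0 < φ s' - φ u' := by linarith [(v3.2.2.2 b4).1, (v3.2.2.2 b4).2]
      have y3 : 0 < ψ s' - ψ u' := by linarith [(v3.2.2.1 a4).1, (v3.2.2.1 a4).2]
      have x4 : φ s - φ u' < 0 := by linarith [(v4.2.2.2 b4).1, (v4.2.2.2 b4).2]
      have y4 : 0 < ψ s - ψ u' := by linarith [(v4.2.2.1 a3).1, (v4.2.2.1 a3).2]
      apply gC_mul (-1 / J) <;> rw [← cross]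
      · nlinarith [mul_pos_of_neg_of_neg x1 y2, mul_neg_of_pos_of_neg x2 y1]
      · nlinarith [mul_pos x2 y3, mul_neg_of_pos_of_neg x3 y2]
      · nlinarith [mul_pos x3 y4, mul_neg_of_neg_of_pos x4 y3]
      · nlinarith [mul_pos_of_neg_of_neg x4 y1, mul_neg_of_neg_of_pos x1 y4]

lemma deriv_pos_ev {f : ℝ → ℝ} {m x : ℝ} (h : HasDerivAt f m x) (hm : 0 < m) :
    ∀ᶠ y in 𝓝 x, (x ≤ y → f x ≤ f y) ∧ (y ≤ x → f y ≤ f x) := by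
  filter_upwards [deriv_est h hm] with y hy
  rw [abs_le] at hy
  constructor
  · intro hxy
    rw [abs_of_nonneg (by linarith)] at hy
    linarith
  · intro hxy
    rw [abs_of_nonpos (by linarith)] at hy
    linarith

lemma deriv_neg_ev {f : ℝ → ℝ} {m x : ℝ} (h : HasDerivAt f m x) (hm : m < 0) :
    ∀ᶠ y in 𝓝 x, (x ≤ y → f y ≤ f x) ∧ (y ≤ x → f x ≤ f y) := by
  filter_upwards [deriv_pos_ev h.neg (neg_pos.2 hm)] with y hy
  simpa using hy

lemma main_even {f g f' g' : ℝ → ℝ} (hf : ∀ x, HasDerivAt f (f' x) x) (hg : ∀ x, HasDerivAt g (g' x) x)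
    {a b c : ℝ} (hab : a < b) (hbc : b < c) (fab : f a = f b) (fcb : f c = f b)
    (gab : g a = g b) (gcb : g c = g b)
    (fa : 0 < f' a) (fb : f' b < 0) (fc : 0 < f' c) (Z : Finset (ℝ × ℝ))
    (hZ : ∀ z ∈ Z, (a < z.1 ∧ z.1 < b) ∧ (b < z.2 ∧ z.2 < c) ∧ f z.1 = f z.2 ∧ g z.1 = g z.2 ∧
      f' z.1 * g' z.2 - g' z.1 * f' z.2 ≠ 0)
    (hzero : ∀ s u, a ≤ s → s ≤ b → b ≤ u → u ≤ c → f s = f u → g s = g u →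
      ((s = a ∨ s = b) ∧ (u = b ∨ u = c)) ∨ (s, u) ∈ Z) : Even Z.card := by
  classical
  have cf : Continuous f := continuous_iff_continuousAt.2 fun x => (hf x).continuousAt
  have cg : Continuous g := continuous_iff_continuousAt.2 fun x => (hg x).continuousAt
  set m := min (b - a) (c - b) with hm
  have hmp : 0 < m := lt_min (by linarith) (by linarith)
  set M := max (b - a) (c - b) with hM
  have hmM : m ≤ M := (min_le_left _ _).trans (le_max_left _ _)
  set K := 16 * M / m with hKd
  have hK : 1 ≤ K := by rw [hKd, le_div_iff₀ hmp]; linarith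
  have loc : ∀ z ∈ Set.Icc a b ×ˢ Set.Icc b c, ∃ U ∈ 𝓝 z, GoodN f g a b c K Z U := by
    rintro ⟨s, u⟩ ⟨⟨h1, h2⟩, h3, h4⟩
    simp only at h1 h2 h3 h4
    by_cases hz : (s, u) ∈ Z
    · obtain ⟨_, _, e1, e2, e3⟩ := hZ _ hz
      exact good_zero a b c K hK Z _ hz (hf _) (hf _) (hg _) (hg _) e1 e2 e3
    · by_cases h0 : f s = f u ∧ g s = g u
      · rcases hzero s u h1 h2 h3 h4 h0.1 h0.2 with ⟨q1, q2⟩ | q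
        · apply good_corner a b c K Z _ hz
          · simp only
            rcases q1 with q | q
            · subst q
              filter_upwards [deriv_pos_ev (hf _) fa] with y hy h _ using hy.1 h
            · subst q
              filter_upwards [deriv_neg_ev (hf _) fb] with y hy _ h using hy.2 h
          · simp only
            rw [h0.1]
            rcases q2 with q | q
            · subst q
              filter_upwards [deriv_neg_ev (hf _) fb] with y hy h _ using hy.1 h
            · subst q
              filter_upwards [deriv_pos_ev (hf _) fc] with y hy _ h using hy.2 h
        · exact absurd q hz
      · exact good_nonzero cf cg a b c K Z _ hz h0
  choose! U hU hUG using loc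
  have hcpt : IsCompact (Set.Icc a b ×ˢ Set.Icc b c) := isCompact_Icc.prod isCompact_Icc
  obtain ⟨r, hr, hL⟩ := lebesgue_number_lemma_of_metric
    (c := fun i : (Set.Icc a b ×ˢ Set.Icc b c : Set (ℝ × ℝ)) => interior (U i)) hcpt
    (fun _ => isOpen_interior)
    (fun z hz => Set.mem_iUnion.2 ⟨⟨z, hz⟩, mem_interior_iff_mem_nhds.2 (hU z hz)⟩)
  have g1 := grid a b hab (Z.image Prod.fst) (by
    intro p hp; obtain ⟨z, hz, rfl⟩ := Finset.mem_image.1 hp; exact (hZ z hz).1)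
  have g2 := grid b c hbc (Z.image Prod.snd) (by
    intro p hp; obtain ⟨z, hz, rfl⟩ := Finset.mem_image.1 hp; exact (hZ z hz).2.1)
  have g3 : ∀ᶠ N : ℕ in atTop, 2 * M / N < r :=
    (tendsto_const_div_atTop_nhds_zero_nat (2 * M)).eventually (gt_mem_nhds hr)
  obtain ⟨N, ⟨x, x0, xN, xI, xs, xd⟩, ⟨y, y0, yN, yI, ys, yd⟩, hN, hN0⟩ :=
    (g1.and (g2.and (g3.and (eventually_gt_atTop 0)))).exists
  have hNr : (0:ℝ) < N := by exact_mod_cast hN0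
  set δ := m / N / 8 with hδd
  have hδ : 0 < δ := by positivity
  have hKδ : K * δ = 2 * M / N := by rw [hKd, hδd]; field_simp; ring
  have gapx : 2 * ((b - a) / N) ≤ K * δ := by
    rw [hKδ, ← mul_div_assoc]; gcongr; exact le_max_left _ _
  have gapy : 2 * ((c - b) / N) ≤ K * δ := by
    rw [hKδ, ← mul_div_assoc]; gcongr; exact le_max_right _ _
  have dx : δ ≤ (b - a) / N / 8 := by rw [hδd]; gcongr; exact min_le_left _ _
  have dy : δ ≤ (c - b) / N / 8 := by rw [hδd]; gcongr; exact min_le_right _ _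
  have hga : g a = g b ∧ g c = g b := ⟨gab, gcb⟩
  have tot := sum_gC (N := N) (M := N) (fun k l => gF f g (x k) (y l))
    (by intro l; simp [gF, x0, xN, fab, hga.1])
    (by intro l; simp [gF, y0, yN, fcb, hga.2])
  have cell : ∀ k ∈ Finset.range N, ∀ l ∈ Finset.range N,
      gC (gF f g (x k) (y l)) (gF f g (x (k+1)) (y l)) (gF f g (x (k+1)) (y (l+1)))
        (gF f g (x k) (y (l+1))) =
      ∑ z ∈ Z, (if x k < z.1 ∧ z.1 ≤ x (k+1) then (1 : ZMod 2) else 0) *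
        (if y l < z.2 ∧ z.2 ≤ y (l+1) then 1 else 0) := by
    intro k hk l hl
    rw [Finset.mem_range] at hk hl
    have base : (x k, y l) ∈ Set.Icc a b ×ˢ Set.Icc b c := ⟨xI k hk.le, yI l hl.le⟩
    obtain ⟨i, hi⟩ := hL _ base
    refine hUG i.1 i.2 δ _ _ _ _ hδ (xs k hk).1 (ys l hl).1 ((xs k hk).2.trans gapx)
      ((ys l hl).2.trans gapy) (xI k hk.le).1 (xI (k+1) hk).2 (yI l hl.le).1 (yI (l+1) hl).2 ?_ ?_
    · rintro ⟨p, q⟩ ⟨⟨hp1, hp2⟩, hq1, hq2⟩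
      simp only at hp1 hp2 hq1 hq2
      apply interior_subset
      apply hi
      rw [Metric.mem_ball, Prod.dist_eq, max_lt_iff, Real.dist_eq, Real.dist_eq, abs_lt, abs_lt]
      have := (xs k hk).2
      have := (ys l hl).2
      simp only
      refine ⟨⟨?_, ?_⟩, ?_, ?_⟩ <;> linarith
    · intro z hz
      have hz1 := Finset.mem_image_of_mem Prod.fst hz
      have hz2 := Finset.mem_image_of_mem Prod.snd hz
      exact ⟨dx.trans (xd k hk.le _ hz1), dx.trans (xd (k+1) hk _ hz1),
        dy.trans (yd l hl.le _ hz2), dy.trans (yd (l+1) hl _ hz2)⟩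
  rw [Finset.sum_congr rfl (fun k hk => Finset.sum_congr rfl (cell k hk))] at tot
  have swap : ∑ k ∈ Finset.range N, ∑ l ∈ Finset.range N, ∑ z ∈ Z,
      (if x k < z.1 ∧ z.1 ≤ x (k+1) then (1 : ZMod 2) else 0) *
        (if y l < z.2 ∧ z.2 ≤ y (l+1) then 1 else 0) = ∑ z ∈ Z, 1 := by
    rw [Finset.sum_congr rfl (fun k _ => Finset.sum_comm), Finset.sum_comm]
    apply Finset.sum_congr rfl
    intro z hz
    obtain ⟨⟨q1, q2⟩, ⟨q3, q4⟩, _⟩ := hZ z hz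
    rw [← Finset.sum_mul_sum, sum_ind x (fun k hk => (xs k hk).1) z.1 (by rwa [x0]) (by rwa [xN]),
      sum_ind y (fun k hk => (ys k hk).1) z.2 (by rwa [y0]) (by rwa [yN]), one_mul]
  rw [swap] at tot
  simp only [Finset.sum_const, nsmul_eq_mul, mul_one] at tot
  exact (ZMod.natCast_eq_zero_iff_even).1 tot

lemma cross_ne {A B : ℝ × ℝ} (h : LinearIndependent ℝ ![A, B]) : A.1 * B.2 - A.2 * B.1 ≠ 0 := by
  rw [LinearIndependent.pair_iff] at h
  intro hD
  have h1 := h B.2 (-A.2) (by ext <;> simp <;> linarith)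
  have h2 := h B.1 (-A.1) (by ext <;> simp <;> linarith)
  have hA : A = 0 := by ext <;> simp <;> linarith [h1.2, h2.2]
  have := h 1 0 (by simp [hA])
  simp at this


/-- Gauss's parity condition: if a crossing sequence `w` (a double occurrence word of
length `2n`) is the Gauss code of a closed plane curve `γ` (a `C¹` immersed closed curve
whose only self-intersections are transverse double points, occurring at the parameters
`t i` in order and labeled by `w i`), then `w` is evenly intersticed: between the two
occurrences of any symbol lies a subword of even length. -/
theorem stmt15 {n : ℕ} {A : Type} [DecidableEq A]
    (γ : ℝ → ℝ × ℝ)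
    (hper : ∀ s : ℝ, γ (s + 1) = γ s)
    (hsmooth : ContDiff ℝ 1 γ)
    (himm : ∀ s : ℝ, deriv γ s ≠ 0)
    (t : Fin (2 * n) → ℝ) (ht : StrictMono t)
    (htrange : ∀ i, t i ∈ Set.Ico (0 : ℝ) 1)
    (w : Fin (2 * n) → A)
    (hw : ∀ a : A, a ∈ Set.range w →
      (Finset.univ.filter fun i => w i = a).card = 2)
    (hcross : ∀ s u : ℝ, s ∈ Set.Ico (0 : ℝ) 1 → u ∈ Set.Ico (0 : ℝ) 1 → s ≠ u →
      (γ s = γ u ↔ ∃ i j : Fin (2 * n), i ≠ j ∧ s = t i ∧ u = t j ∧ w i = w j))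
    (htrans : ∀ i j : Fin (2 * n), i ≠ j → w i = w j →
      LinearIndependent ℝ ![deriv γ (t i), deriv γ (t j)]) :
    ∀ i j : Fin (2 * n), i < j → w i = w j → Even ((j : ℕ) - (i : ℕ) - 1) := by
  intro i j hij hwij
  classical
  have hpart : ∀ k, ∃ l, l ≠ k ∧ w l = w k ∧ ∀ m, w m = w k → m = k ∨ m = l := by
    intro k
    obtain ⟨p, q, hpq, he⟩ := Finset.card_eq_two.1 (hw (w k) ⟨k, rfl⟩)
    have hm : ∀ m, w m = w k ↔ m = p ∨ m = q := by
      intro m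
      have : m ∈ Finset.univ.filter (fun i => w i = w k) ↔ m ∈ ({p, q} : Finset _) := by rw [he]
      simpa using this
    rcases (hm k).1 rfl with h | h
    · refine ⟨q, ?_, (hm q).2 (Or.inr rfl), fun m h' => ?_⟩
      · rw [h]; exact hpq.symm
      · rw [h]; exact (hm m).1 h'
    · refine ⟨p, ?_, (hm p).2 (Or.inl rfl), fun m h' => ?_⟩
      · rw [h]; exact hpq
      · rw [h]; exact ((hm m).1 h').symm
  choose σ σne σw σu using hpart
  have σσ : ∀ k, σ (σ k) = k := by
    intro k
    rcases σu (σ k) k (σw k).symm with h | h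
    · exact absurd h.symm (σne k)
    · exact h.symm
  have σeq : ∀ k l, k ≠ l → w k = w l → l = σ k := by
    intro k l h1 h2
    rcases σu k l h2.symm with h | h
    · exact absurd h.symm h1
    · exact h
  have σi : j = σ i := σeq i j hij.ne hwij
  have σj : i = σ j := σeq j i hij.ne' hwij.symm
  have σni : ∀ k, k ≠ j → σ k ≠ i := by
    intro k hk h
    apply hk; rw [← σσ k, h, ← σi]
  have σnj : ∀ k, k ≠ i → σ k ≠ j := by
    intro k hk h
    apply hk; rw [← σσ k, h, ← σj]
  have hd : ∀ s, HasDerivAt γ (deriv γ s) s := fun s =>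
    ((hsmooth.differentiable (by norm_num)) s).hasDerivAt
  have hdx : ∀ s, HasDerivAt (fun s => (γ s).1) (deriv γ s).1 s := fun s => (hd s).fst
  have hdy : ∀ s, HasDerivAt (fun s => (γ s).2) (deriv γ s).2 s := fun s => (hd s).snd
  have hdper : ∀ s, deriv γ (s + 1) = deriv γ s := by
    intro s
    have h1 : (fun x => γ (x + 1)) = γ := funext hper
    rw [← deriv_comp_add_const, h1]
  obtain ⟨A, hA⟩ : ∃ A, A = deriv γ (t i) := ⟨_, rfl⟩
  obtain ⟨B, hB⟩ : ∃ B, B = deriv γ (t j) := ⟨_, rfl⟩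
  have hD : A.1 * B.2 - A.2 * B.1 ≠ 0 := by
    rw [hA, hB]; exact cross_ne (htrans i j hij.ne hwij)
  obtain ⟨D, hDd⟩ : ∃ D, D = A.1 * B.2 - A.2 * B.1 := ⟨_, rfl⟩
  rw [← hDd] at hD
  have hDD : 0 < D * D := mul_self_pos.2 hD
  let lift : Fin (2 * n) → ℝ := fun l => if j < l then t l else t l + 1
  have hγl : ∀ l, γ (lift l) = γ (t l) := by
    intro l; simp only [lift]; split_ifs
    · rfl
    · exact hper _
  have hdl : ∀ l, deriv γ (lift l) = deriv γ (t l) := by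
    intro l; simp only [lift]; split_ifs
    · rfl
    · exact hdper _
  have hγ : ∀ k l, k ≠ l → w k = w l → γ (t k) = γ (t l) := fun k l h1 h2 =>
    (hcross _ _ (htrange k) (htrange l) (fun h => h1 (ht.injective h))).2 ⟨k, l, h1, rfl, rfl, h2⟩
  have hγij : γ (t i) = γ (t j) := hγ i j hij.ne hwij
  let S := (Finset.Ioo i j).filter fun k => ¬ (i ≤ σ k ∧ σ k ≤ j)
  have hSeven : Even S.card := by
    have hinj : Function.Injective fun k => (t k, lift (σ k)) := by
      intro k l h
      exact ht.injective (Prod.ext_iff.1 h).1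
    rw [← Finset.card_image_of_injective S hinj]
    have htij := ht hij
    have hti := htrange i
    have htj := htrange j
    refine main_even
      (f := fun s => D * ((γ s).1 * (B.2 + A.2) - (γ s).2 * (B.1 + A.1)))
      (g := fun s => (γ s).1 * (B.2 - A.2) - (γ s).2 * (B.1 - A.1))
      (f' := fun s => D * ((deriv γ s).1 * (B.2 + A.2) - (deriv γ s).2 * (B.1 + A.1)))
      (g' := fun s => (deriv γ s).1 * (B.2 - A.2) - (deriv γ s).2 * (B.1 - A.1))
      (a := t i) (b := t j) (c := t i + 1) ?_ ?_ htij (by linarith [hti.1, htj.2]) ?_ ?_ ?_ ?_ ?_ ?_ ?_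
      _ ?_ ?_
    · intro s
      exact (((hdx s).mul_const _).sub ((hdy s).mul_const _)).const_mul D
    · intro s
      exact ((hdx s).mul_const _).sub ((hdy s).mul_const _)
    · simp only [hγij]
    · simp only [hper, hγij]
    · simp only [hγij]
    · simp only [hper, hγij]
    · simp only [← hA]
      have : D * (A.1 * (B.2 + A.2) - A.2 * (B.1 + A.1)) = D * D := by
        congr 1; rw [hDd]; ring
      rw [this]; exact hDD
    · simp only [← hB]
      have : D * (B.1 * (B.2 + A.2) - B.2 * (B.1 + A.1)) = -(D * D) := by
        rw [← mul_neg]; congr 1; rw [hDd]; ring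
      rw [this]; linarith
    · simp only [hdper, ← hA]
      have : D * (A.1 * (B.2 + A.2) - A.2 * (B.1 + A.1)) = D * D := by
        congr 1; rw [hDd]; ring
      rw [this]; exact hDD
    · intro z hz
      obtain ⟨k, hk, rfl⟩ := Finset.mem_image.1 hz
      obtain ⟨hk1, hk2⟩ := Finset.mem_filter.1 hk
      obtain ⟨hk3, hk4⟩ := Finset.mem_Ioo.1 hk1
      have hkk : γ (lift (σ k)) = γ (t k) := by rw [hγl]; exact hγ _ _ (σne k) (σw k)
      simp only
      refine ⟨⟨ht hk3, ht hk4⟩, ?_, ?_, ?_, ?_⟩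
      · by_cases hl : j < σ k
        · simp only [lift, if_pos hl]
          exact ⟨ht hl, by linarith [(htrange (σ k)).2, hti.1]⟩
        · simp only [lift, if_neg hl]
          have : σ k < i := by
            by_contra h; exact hk2 ⟨not_lt.1 h, not_lt.1 hl⟩
          exact ⟨by linarith [(htrange (σ k)).1, htj.2], by linarith [ht this]⟩
      · rw [hkk]
      · rw [hkk]
      · rw [hdl]
        have := cross_ne (htrans k (σ k) (σne k).symm (σw k).symm)
        generalize deriv γ (t k) = X at *
        generalize deriv γ (t (σ k)) = Y at *
        have e : D * (X.1 * (B.2 + A.2) - X.2 * (B.1 + A.1)) * (Y.1 * (B.2 - A.2) - Y.2 * (B.1 - A.1)) -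
          (X.1 * (B.2 - A.2) - X.2 * (B.1 - A.1)) * (D * (Y.1 * (B.2 + A.2) - Y.2 * (B.1 + A.1))) =
          2 * (D * (A.1 * B.2 - A.2 * B.1)) * (X.1 * Y.2 - X.2 * Y.1) := by ring
        rw [e, ← hDd]
        exact mul_ne_zero (mul_ne_zero two_ne_zero hDD.ne') this
    · intro s u h1 h2 h3 h4 e1 e2
      have e1' := mul_left_cancel₀ hD e1
      have hγsu : γ s = γ u := by
        have p1 : ((γ s).1 - (γ u).1) * B.2 = ((γ s).2 - (γ u).2) * B.1 := by linarith
        have p2 : ((γ s).1 - (γ u).1) * A.2 = ((γ s).2 - (γ u).2) * A.1 := by linarith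
        have q1 : D * ((γ s).1 - (γ u).1) = 0 := by
          rw [hDd]; linear_combination A.1 * p1 - B.1 * p2
        have q2 : D * ((γ s).2 - (γ u).2) = 0 := by
          rw [hDd]; linear_combination A.2 * p1 - B.2 * p2
        ext
        · linarith [(mul_eq_zero.1 q1).resolve_left hD]
        · linarith [(mul_eq_zero.1 q2).resolve_left hD]
      have hs : s ∈ Set.Ico (0:ℝ) 1 := ⟨hti.1.trans h1, h2.trans_lt htj.2⟩
      have fin : ∀ k l, s = t k → k ≠ l → w k = w l → u = lift l → l ≠ i → l ≠ j →
          ¬ (i ≤ l ∧ l ≤ j) → (s, u) ∈ Finset.image (fun k => (t k, lift (σ k))) S := by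
        intro k l hsk hkl hwkl hul hli hlj hn
        have hl := σeq k l hkl hwkl
        refine Finset.mem_image.2 ⟨k, Finset.mem_filter.2 ⟨Finset.mem_Ioo.2 ⟨?_, ?_⟩, ?_⟩, ?_⟩
        · apply lt_of_le_of_ne
          · rw [← ht.le_iff_le, ← hsk]; exact h1
          · rintro rfl; exact hlj (hl.trans σi.symm)
        · apply lt_of_le_of_ne
          · rw [← ht.le_iff_le, ← hsk]; exact h2
          · rintro rfl; exact hli (hl.trans σj.symm)
        · rw [← hl]; exact hn
        · rw [← hl, hsk, hul]
      by_cases hu : u < 1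
      · by_cases hsu : s = u
        · left; exact ⟨Or.inr (by linarith), Or.inl (by linarith)⟩
        · obtain ⟨k, l, hkl, hk, hl, hwkl⟩ := (hcross s u hs ⟨htj.1.trans h3, hu⟩ hsu).1 hγsu
          have hjl : j ≤ l := by rw [← ht.le_iff_le, ← hl]; exact h3
          by_cases hlj : l = j
          · left
            have : k = i := by
              rw [σj, ← hlj]; exact σeq l k hkl.symm hwkl.symm
            exact ⟨Or.inl (by rw [hk, this]), Or.inl (by rw [hl, hlj])⟩
          · right
            have hjl' : j < l := lt_of_le_of_ne hjl (Ne.symm hlj)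
            exact fin k l hk hkl hwkl (by simp only [lift, if_pos hjl', hl]) (hij.trans hjl').ne' hlj
              (fun h => absurd h.2 (not_le.2 hjl'))
      · by_cases hsu : s = u - 1
        · left; exact ⟨Or.inl (by linarith), Or.inr (by linarith)⟩
        · have hγ' : γ s = γ (u - 1) := by rw [hγsu, ← hper (u - 1), sub_add_cancel]
          obtain ⟨k, l, hkl, hk, hl, hwkl⟩ :=
            (hcross s (u - 1) hs ⟨by linarith, by linarith [hti.2]⟩ hsu).1 hγ'
          have hli : l ≤ i := by rw [← ht.le_iff_le, ← hl]; linarith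
          by_cases hlj : l = i
          · left
            have : k = j := by
              rw [σi, ← hlj]; exact σeq l k hkl.symm hwkl.symm
            exact ⟨Or.inr (by rw [hk, this]), Or.inr (by rw [← hlj, ← hl]; ring)⟩
          · right
            have hli' : l < i := lt_of_le_of_ne hli hlj
            have hnj : ¬ j < l := not_lt.2 (hli.trans hij.le)
            exact fin k l hk hkl hwkl (by simp only [lift, if_neg hnj, ← hl]; ring) hlj
              (hli'.trans hij).ne (fun h => absurd h.1 (not_le.2 hli'))
  have hTeven : Even ((Finset.Ioo i j).filter fun k => i ≤ σ k ∧ σ k ≤ j).card := by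
    rw [← ZMod.natCast_eq_zero_iff_even]
    have : ∑ k ∈ (Finset.Ioo i j).filter (fun k => i ≤ σ k ∧ σ k ≤ j), (1 : ZMod 2) = 0 := by
      refine Finset.sum_involution (fun k _ => σ k) (fun _ _ => by decide) (fun k _ _ => σne k) ?_
        (fun k _ => σσ k)
      intro k hk
      obtain ⟨hk1, hk2, hk3⟩ := Finset.mem_filter.1 hk
      obtain ⟨hk4, hk5⟩ := Finset.mem_Ioo.1 hk1
      refine Finset.mem_filter.2 ⟨Finset.mem_Ioo.2 ⟨?_, ?_⟩, ?_⟩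
      · exact lt_of_le_of_ne hk2 (σni k hk5.ne).symm
      · exact lt_of_le_of_ne hk3 (σnj k hk4.ne')
      · rw [σσ]; exact ⟨hk4.le, hk5.le⟩
    simpa using this
  have hcard := Finset.card_filter_add_card_filter_not (s := Finset.Ioo i j)
    (fun k => i ≤ σ k ∧ σ k ≤ j)
  rw [Fin.card_Ioo] at hcard
  rw [← hcard]
  exact hTeven.add hSeven
end

section
/- Let S be a cyclic double occurrence word of length 2n that is realizable as the Gauss code of a closed plane curve. Then the interlacement graph of the fully split sequence S* (with chords given by the pairs P, P̄ of split symbols, and interlacement taken in the cyclic word S*) is bipartite. -/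
/-- A letter: an unsplit symbol from `A`, or a split symbol from `B` with an orientation
bit. -/
abbrev Letter (A B : Type) := A ⊕ (B × Bool)

/-- Toggle the orientation of a split symbol. -/
def toggle {A B : Type} : Letter A B → Letter A B
  | .inl a => .inl a
  | .inr (P, b) => .inr (P, !b)

/-- Splitting at a symbol `p`: replace `S = α p β p γ` by `α P β⁻¹ P̄ γ` (with `β`
reversed and orientations of previously split symbols in it toggled), `P` fresh. -/
def SplitStep {A B : Type} (S T : List (Letter A B)) : Prop :=
  ∃ (α β γ : List (Letter A B)) (p : A) (P : B),
    (∀ b : Bool, Sum.inr (P, b) ∉ S) ∧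
    S = α ++ .inl p :: β ++ .inl p :: γ ∧
    T = α ++ .inr (P, false) :: (β.reverse.map toggle) ++ .inr (P, true) :: γ

/-- The split symbol `P` occurs at position `i` of `T`. -/
def occursAt {A B : Type} (T : List (Letter A B)) (P : B) (i : Fin T.length) : Prop :=
  ∃ b : Bool, T.get i = Sum.inr (P, b)

/-- The chords `P` and `Q` (pairs of occurrences of split symbols) interlace in the
cyclic word `T`: their occurrences alternate cyclically. -/
def CrossIn {A B : Type} (T : List (Letter A B)) (P Q : B) : Prop :=
  ∃ i j k l : Fin T.length, i < j ∧ occursAt T P i ∧ occursAt T P j ∧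
    occursAt T Q k ∧ occursAt T Q l ∧ k ≠ l ∧
    Xor' (i < k ∧ k < j) (i < l ∧ l < j)

section
open Topology Filter Set

theorem g_exists_log (K : Set (ℝ × ℝ)) (hK : Convex ℝ K) (hne : K.Nonempty) (q : ℝ × ℝ → ℂ)
    (hq : ContinuousOn q K) (h0 : ∀ z ∈ K, q z ≠ 0) :
    ∃ l : ℝ × ℝ → ℂ, ContinuousOn l K ∧ ∀ z ∈ K, Complex.exp (l z) = q z := by
  classical
  have := hK.locallyPathConnectedSpace
  have := hK.contractibleSpace hne
  obtain ⟨z0, hz0⟩ := hne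
  let f : C(K, {z : ℂ // z ≠ 0}) := ⟨fun z => ⟨q z, h0 z z.2⟩, by
    refine Continuous.subtype_mk ?_ _
    exact continuousOn_iff_continuous_domRestrict.mp hq⟩
  obtain ⟨F, ⟨hF1, hF2⟩, -⟩ := Complex.isCoveringMap_exp.existsUnique_continuousMap_lifts f
    ⟨z0, hz0⟩ (Complex.log (q z0)) (by
      apply Subtype.ext; simp [f, Complex.exp_log (h0 z0 hz0)])
  refine ⟨fun z => if h : z ∈ K then F ⟨z, h⟩ else 0, ?_, ?_⟩
  · rw [continuousOn_iff_continuous_domRestrict]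
    convert F.continuous using 1
    ext z
    simp
  · intro z hz
    have := congrFun hF2 ⟨z, hz⟩
    have := congrArg Subtype.val this
    simpa [hz, f] using this

theorem g_const {f : ℝ → ℝ} {b1 b2 : ℝ} (hb : b1 < b2) (hf : ContinuousOn f (Icc b1 b2))
    (K : ℂ) (hK : K ≠ 0) (h : ∀ u ∈ Icc b1 b2, (Complex.exp (f u * Complex.I) * K).im = 0) :
    f b1 = f b2 := by
  have key : ∀ u ∈ Icc b1 b2, Real.sin (f u - f b1) = 0 := by
    intro u hu
    have h1 := h u hu
    have h2 := h b1 ⟨le_rfl, hb.le⟩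
    simp only [Complex.mul_im, Complex.exp_ofReal_mul_I_re, Complex.exp_ofReal_mul_I_im] at h1 h2
    rw [Real.sin_sub]
    by_cases hre : K.re = 0
    · have him : K.im ≠ 0 := fun hh => hK (Complex.ext hre hh)
      simp only [hre, mul_zero, add_zero, mul_eq_zero, him, or_false] at h1 h2
      simp [h1, h2]
    · have := sub_eq_zero.mpr h1
      apply mul_right_cancel₀ hre
      linear_combination Real.cos (f b1) * h1 - Real.cos (f u) * h2
  by_contra hne
  have hIccsub : Icc (min (f b1) (f b2)) (max (f b1) (f b2)) ⊆ f '' Icc b1 b2 := by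
    have := intermediate_value_uIcc (f := f) (a := b1) (b := b2) (by rwa [uIcc_of_le hb.le])
    rwa [uIcc_of_le hb.le] at this
  have : ∃ v ∈ Icc (min (f b1) (f b2)) (max (f b1) (f b2)), v ≠ f b1 ∧ |v - f b1| < Real.pi := by
    have hp := Real.pi_pos
    rcases lt_or_gt_of_ne hne with hlt | hlt
    · refine ⟨min (f b2) (f b1 + 1), ⟨?_, ?_⟩, ?_, ?_⟩
      · simp [hlt.le]
      · simp [hlt.le]
      · exact (lt_min hlt (by linarith)).ne'
      · rw [abs_lt]
        have := lt_min hlt (show f b1 < f b1 + 1 by linarith)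
        have := min_le_right (f b2) (f b1 + 1)
        have := Real.pi_gt_three
        constructor <;> linarith
    · refine ⟨max (f b2) (f b1 - 1), ⟨?_, ?_⟩, ?_, ?_⟩
      · simp [hlt.le]
      · simp [hlt.le]
      · exact (max_lt hlt (by linarith)).ne
      · rw [abs_lt]
        have := max_lt hlt (show f b1 - 1 < f b1 by linarith)
        have := le_max_right (f b2) (f b1 - 1)
        have := Real.pi_gt_three
        constructor <;> linarith
  obtain ⟨v, hv, hvne, hvlt⟩ := this
  obtain ⟨u, hu, rfl⟩ := hIccsub hv
  have := key u hu
  rw [abs_lt] at hvlt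
  rw [Real.sin_eq_zero_iff_of_lt_of_lt hvlt.1 hvlt.2] at this
  exact hvne (by linarith)

theorem g_dense {b1 b2 : ℝ} (hb : b1 < b2) (s : Set ℝ) (hs : s.Finite) :
    Icc b1 b2 ⊆ closure (Icc b1 b2 \ s) := by
  have h1 : Icc b1 b2 = closure (Ioo b1 b2) := (closure_Ioo hb.ne).symm
  have hd : Dense (sᶜ) := hs.countable.dense_compl ℝ
  have h2 : Ioo b1 b2 ⊆ closure (Ioo b1 b2 ∩ sᶜ) := by
    exact (hd.open_subset_closure_inter isOpen_Ioo)
  calc Icc b1 b2 = closure (Ioo b1 b2) := h1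
    _ ⊆ closure (Ioo b1 b2 ∩ sᶜ) := closure_minimal h2 isClosed_closure
    _ ⊆ closure (Icc b1 b2 \ s) :=
      closure_mono (by rintro x ⟨hx, hx'⟩; exact ⟨Ioo_subset_Icc_self hx, hx'⟩)

/-- Edge lemma: comparing two continuous logarithms along an interval. -/
theorem g_edge {κ : Type*} [Fintype κ] {b1 b2 : ℝ} (hb : b1 < b2) (s : Set ℝ) (hs : s.Finite)
    (L1 L2 : ℝ → ℂ) (hL1 : ContinuousOn L1 (Icc b1 b2)) (hL2 : ContinuousOn L2 (Icc b1 b2))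
    (f1 f2 : κ → ℝ → ℂ) (V1 V2 : κ → ℝ → ℝ)
    (hV1 : ∀ k, Continuous (V1 k)) (hV2 : ∀ k, Continuous (V2 k))
    (h1 : ∀ k, ∃ K : ℂ, K ≠ 0 ∧ ∀ u, ∃ r : ℝ, f1 k u = r * K * Complex.exp (V1 k u * Complex.I))
    (h2 : ∀ k, ∃ K : ℂ, K ≠ 0 ∧ ∀ u, ∃ r : ℝ, f2 k u = r * K * Complex.exp (V2 k u * Complex.I))
    (h : ∀ u ∈ Icc b1 b2 \ s, ∃ r1 r2 : ℝ,
      r1 * Complex.exp (L1 u) * ∏ k, f1 k u = r2 * Complex.exp (L2 u) * ∏ k, f2 k u ∧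
      r1 * Complex.exp (L1 u) * ∏ k, f1 k u ≠ 0) :
    (L1 b1).im - (L2 b1).im + ∑ k, (V1 k b1 - V2 k b1) =
      (L1 b2).im - (L2 b2).im + ∑ k, (V1 k b2 - V2 k b2) := by
  choose K1 hK1 R1 hR1 using h1
  choose K2 hK2 R2 hR2 using h2
  set F : ℝ → ℝ := fun u => (L1 u).im - (L2 u).im + ∑ k, (V1 k u - V2 k u) with hF
  have hFc : ContinuousOn F (Icc b1 b2) := by
    refine ContinuousOn.add (ContinuousOn.sub ?_ ?_) (Continuous.continuousOn ?_)
    · exact Complex.continuous_im.comp_continuousOn hL1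
    · exact Complex.continuous_im.comp_continuousOn hL2
    · exact continuous_finsetSum _ (fun k _ => (hV1 k).sub (hV2 k))
  have hP1 : ∏ k, K1 k ≠ 0 := Finset.prod_ne_zero_iff.mpr (fun k _ => hK1 k)
  have hP2 : ∏ k, K2 k ≠ 0 := Finset.prod_ne_zero_iff.mpr (fun k _ => hK2 k)
  refine g_const (f := F) hb hFc ((∏ k, K1 k) / ∏ k, K2 k) (div_ne_zero hP1 hP2) ?_
  have good : ∀ u ∈ Icc b1 b2 \ s,
      (Complex.exp (F u * Complex.I) * ((∏ k, K1 k) / ∏ k, K2 k)).im = 0 := by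
    intro u hu
    obtain ⟨r1, r2, he, hn⟩ := h u hu
    have e1 : ∏ k, f1 k u = ((∏ k, R1 k u : ℝ) : ℂ) * (∏ k, K1 k) *
        Complex.exp ((∑ k, V1 k u : ℝ) * Complex.I) := by
      simp_rw [hR1, Finset.prod_mul_distrib]
      push_cast
      rw [Finset.sum_mul, Complex.exp_sum]
    have e2 : ∏ k, f2 k u = ((∏ k, R2 k u : ℝ) : ℂ) * (∏ k, K2 k) *
        Complex.exp ((∑ k, V2 k u : ℝ) * Complex.I) := by
      simp_rw [hR2, Finset.prod_mul_distrib]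
      push_cast
      rw [Finset.sum_mul, Complex.exp_sum]
    have el : ∀ z : ℂ, Complex.exp z = (Real.exp z.re : ℝ) * Complex.exp (z.im * Complex.I) := by
      intro z
      conv_lhs => rw [← Complex.re_add_im z, Complex.exp_add]
      simp
    rw [e1, el] at hn
    rw [e1, e2, el (L1 u), el (L2 u)] at he
    set A := r1 * Real.exp (L1 u).re * ∏ k, R1 k u with hA
    set B := r2 * Real.exp (L2 u).re * ∏ k, R2 k u with hB
    have hA0 : A ≠ 0 := by
      intro h0
      apply hn
      have h0' : (A : ℂ) = 0 := by exact_mod_cast h0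
      rw [hA] at h0'
      push_cast at h0' ⊢
      linear_combination (Complex.exp ((L1 u).im * Complex.I) * (∏ k, K1 k) *
        Complex.exp ((∑ k, (V1 k u : ℂ)) * Complex.I)) * h0'
    have hFu : Complex.exp (F u * Complex.I) = Complex.exp ((L1 u).im * Complex.I) *
        Complex.exp ((∑ k, V1 k u : ℝ) * Complex.I) /
        (Complex.exp ((L2 u).im * Complex.I) * Complex.exp ((∑ k, V2 k u : ℝ) * Complex.I)) := by
      rw [← Complex.exp_add, ← Complex.exp_add, ← Complex.exp_sub]
      congr 1
      rw [hF]
      simp only [Finset.sum_sub_distrib]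
      push_cast
      ring
    have hreal : Complex.exp (F u * Complex.I) * ((∏ k, K1 k) / ∏ k, K2 k) = ((B / A : ℝ) : ℂ) := by
      rw [hFu]
      have hA0' : (A : ℂ) ≠ 0 := by exact_mod_cast hA0
      have x1 := Complex.exp_ne_zero ((L2 u).im * Complex.I)
      have x2 := Complex.exp_ne_zero ((∑ k, V2 k u : ℝ) * Complex.I)
      have hAe : (A : ℂ) = r1 * Real.exp (L1 u).re * (∏ k, R1 k u : ℝ) := by
        rw [hA]; push_cast; ring
      have hBe : (B : ℂ) = r2 * Real.exp (L2 u).re * (∏ k, R2 k u : ℝ) := by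
        rw [hB]; push_cast; ring
      generalize Complex.exp ((L2 u).im * Complex.I) = X1 at *
      generalize Complex.exp ((∑ k, V2 k u : ℝ) * Complex.I) = X2 at *
      generalize Complex.exp ((L1 u).im * Complex.I) = X3 at *
      generalize Complex.exp ((∑ k, V1 k u : ℝ) * Complex.I) = X4 at *
      rw [Complex.ofReal_div, div_mul_div_comm, div_eq_div_iff
        (mul_ne_zero (mul_ne_zero x1 x2) hP2) hA0', hAe, hBe]
      linear_combination he
    rw [hreal, Complex.ofReal_im]
  intro u hu
  have hcl : ContinuousOn (fun u => (Complex.exp (F u * Complex.I) *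
      ((∏ k, K1 k) / ∏ k, K2 k)).im) (Icc b1 b2) := by
    have : ContinuousOn (fun u => ((F u : ℝ) : ℂ)) (Icc b1 b2) :=
      Complex.continuous_ofReal.comp_continuousOn hFc
    fun_prop
  have hu' := g_dense hb s hs hu
  have := mem_closure_iff_nhdsWithin_neBot.mp hu'
  have t1 := (hcl u hu).mono_left (nhdsWithin_mono u (sdiff_subset (t := s)))
  have t2 : Tendsto (fun u => (Complex.exp (F u * Complex.I) *
      ((∏ k, K1 k) / ∏ k, K2 k)).im) (𝓝[Icc b1 b2 \ s] u) (𝓝 0) := by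
    refine tendsto_const_nhds.congr' ?_
    filter_upwards [self_mem_nhdsWithin] with v hv
    exact (good v hv).symm
  exact tendsto_nhds_unique t1 t2

noncomputable def gV (τ : ℂ) (x y : ℝ) : ℝ := Complex.arg (τ - ((y / x : ℝ) : ℂ))
noncomputable def gW (τ : ℂ) (x y : ℝ) : ℝ := Complex.arg (1 - ((x / y : ℝ) : ℂ) * τ)
noncomputable def gS (x : ℝ) : ℤ := if 0 < x then 1 else if x < 0 then -1 else 0
noncomputable def gD (τ : ℂ) (x y : ℝ) : ℝ := gV τ x y - gW τ x y
noncomputable def gAlt (τ : ℂ) (x1 x2 y1 y2 : ℝ) : ℝ :=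
  gD τ x2 y2 - gD τ x1 y2 - gD τ x2 y1 + gD τ x1 y1

theorem gV_cont (τ : ℂ) (hτ : τ.im ≠ 0) (x : ℝ) : Continuous (fun y => gV τ x y) := by
  rw [continuous_iff_continuousAt]
  intro y
  unfold gV
  refine ContinuousAt.comp (f := fun y : ℝ => τ - ((y / x : ℝ) : ℂ)) (g := Complex.arg)
    (Complex.continuousAt_arg ?_) (by fun_prop)
  right
  simpa using hτ

theorem gW_cont (τ : ℂ) (hτ : τ.im ≠ 0) (y : ℝ) : Continuous (fun x => gW τ x y) := by
  rw [continuous_iff_continuousAt]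
  intro x
  unfold gW
  refine ContinuousAt.comp (f := fun x : ℝ => 1 - ((x / y : ℝ) : ℂ) * τ) (g := Complex.arg)
    (Complex.continuousAt_arg ?_) (by fun_prop)
  by_cases h : x / y = 0
  · left; rw [h]; simp
  · right
    rw [Complex.sub_im, Complex.im_ofReal_mul, Complex.one_im]
    simpa [hτ] using h

theorem gV_rep (c c' : ℂ) (h : (c / c').im ≠ 0) (x : ℝ) : ∃ K : ℂ, K ≠ 0 ∧ ∀ y : ℝ, ∃ r : ℝ,
    c * x - c' * y = r * K * Complex.exp (gV (c / c') x y * Complex.I) := by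
  have hc' : c' ≠ 0 := by rintro rfl; simp at h
  by_cases hx : x = 0
  · subst hx
    refine ⟨c' * Complex.exp (-(Complex.arg (c / c') * Complex.I)),
      mul_ne_zero hc' (Complex.exp_ne_zero _), fun y => ⟨-y, ?_⟩⟩
    simp only [gV, div_zero, Complex.ofReal_zero, sub_zero, mul_zero, zero_sub, Complex.ofReal_neg]
    rw [mul_assoc, mul_assoc, ← Complex.exp_add, neg_add_cancel, Complex.exp_zero]
    ring
  · refine ⟨c', hc', fun y => ⟨x * ‖c / c' - ((y / x : ℝ) : ℂ)‖, ?_⟩⟩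
    have := Complex.norm_mul_exp_arg_mul_I (c / c' - ((y / x : ℝ) : ℂ))
    unfold gV
    have hx' : (x : ℂ) ≠ 0 := by exact_mod_cast hx
    have e : c * x - c' * y = x * c' * (c / c' - ((y / x : ℝ) : ℂ)) := by
      push_cast; field_simp
    rw [e]
    generalize c / c' - ((y / x : ℝ) : ℂ) = z at *
    conv_lhs => rw [← this]
    push_cast
    ring

theorem gW_rep (c c' : ℂ) (h : (c / c').im ≠ 0) (y : ℝ) : ∃ K : ℂ, K ≠ 0 ∧ ∀ x : ℝ, ∃ r : ℝ,
    c * x - c' * y = r * K * Complex.exp (gW (c / c') x y * Complex.I) := by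
  have hc' : c' ≠ 0 := by rintro rfl; simp at h
  have hc : c ≠ 0 := by rintro rfl; simp at h
  by_cases hy : y = 0
  · subst hy
    refine ⟨c, hc, fun x => ⟨x, ?_⟩⟩
    simp [gW, mul_comm]
  · refine ⟨c', hc', fun x => ⟨-y * ‖1 - ((x / y : ℝ) : ℂ) * (c / c')‖, ?_⟩⟩
    have := Complex.norm_mul_exp_arg_mul_I (1 - ((x / y : ℝ) : ℂ) * (c / c'))
    unfold gW
    have hy' : (y : ℂ) ≠ 0 := by exact_mod_cast hy
    have e : c * x - c' * y = -y * c' * (1 - ((x / y : ℝ) : ℂ) * (c / c')) := by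
      push_cast; field_simp; ring
    rw [e]
    generalize 1 - ((x / y : ℝ) : ℂ) * (c / c') = z at *
    conv_lhs => rw [← this]
    push_cast
    ring

theorem gD_zero (τ : ℂ) (x y : ℝ) (h : x = 0 ∨ y = 0) : gD τ x y = Complex.arg τ := by
  rcases h with rfl | rfl <;> simp [gD, gV, gW]

theorem gD_neg (τ : ℂ) (x y : ℝ) (h : x * y < 0) : gD τ x y = 0 := by
  have hx : x ≠ 0 := by rintro rfl; simp at h
  have hy : y ≠ 0 := by rintro rfl; simp at h
  have hp : 0 < -(y / x) := by
    rw [neg_pos]; exact div_neg_iff.mpr (by rcases mul_neg_iff.mp h with h | h <;> tauto)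
  have hx' : (x : ℂ) ≠ 0 := by exact_mod_cast hx
  have hy' : (y : ℂ) ≠ 0 := by exact_mod_cast hy
  have : τ - ((y / x : ℝ) : ℂ) = ((-(y / x) : ℝ) : ℂ) * (1 - ((x / y : ℝ) : ℂ) * τ) := by
    push_cast; field_simp; ring
  unfold gD gV gW
  rw [this, Complex.arg_real_mul _ hp, sub_self]

theorem gD_pos (τ : ℂ) (hτ : τ.im ≠ 0) (x y : ℝ) (h : 0 < x * y) :
    gD τ x y = Real.pi * gS τ.im := by
  have hx : x ≠ 0 := by rintro rfl; simp at h
  have hy : y ≠ 0 := by rintro rfl; simp at h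
  have hp : 0 < y / x := div_pos_iff.mpr (by rcases mul_pos_iff.mp h with h | h <;> tauto)
  have hp' : 0 < x / y := div_pos_iff.mpr (by rcases mul_pos_iff.mp h with h | h <;> tauto)
  have hx' : (x : ℂ) ≠ 0 := by exact_mod_cast hx
  have hy' : (y : ℂ) ≠ 0 := by exact_mod_cast hy
  have e : τ - ((y / x : ℝ) : ℂ) = ((y / x : ℝ) : ℂ) * (-(1 - ((x / y : ℝ) : ℂ) * τ)) := by
    push_cast; field_simp; ring
  unfold gD gV gW
  rw [e, Complex.arg_real_mul _ hp]
  have him : (1 - ((x / y : ℝ) : ℂ) * τ).im = -(x / y * τ.im) := by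
    rw [Complex.sub_im, Complex.im_ofReal_mul, Complex.one_im]; ring
  rcases lt_or_gt_of_ne hτ with hlt | hlt
  · rw [Complex.arg_neg_eq_arg_sub_pi_of_im_pos (by rw [him]; have := mul_neg_of_pos_of_neg hp' hlt; linarith)]
    simp [gS, hlt, hlt.le]
  · rw [Complex.arg_neg_eq_arg_add_pi_of_im_neg (by rw [him]; have := mul_pos hp' hlt; linarith)]
    simp [gS, hlt]

theorem gAlt_noncorner (τ : ℂ) (hτ : τ.im ≠ 0) (x1 x2 y1 y2 : ℝ) (hx : x1 < x2) (hy : y1 < y2)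
    (hc : ¬ ((x1 = 0 ∨ x2 = 0) ∧ (y1 = 0 ∨ y2 = 0))) :
    gAlt τ x1 x2 y1 y2 =
      Real.pi / 2 * ((gS τ.im * (gS x2 - gS x1) * (gS y2 - gS y1) : ℤ) : ℝ) := by
  have pos : ∀ x : ℝ, 0 < x → gS x = 1 := fun x h => by simp [gS, h]
  have neg : ∀ x : ℝ, x < 0 → gS x = -1 := fun x h => by simp [gS, h, h.le]
  have zer : gS 0 = 0 := by simp [gS]
  have dpp : ∀ x y : ℝ, 0 < x → 0 < y → gD τ x y = Real.pi * gS τ.im :=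
    fun x y h h' => gD_pos τ hτ x y (mul_pos h h')
  have dnn : ∀ x y : ℝ, x < 0 → y < 0 → gD τ x y = Real.pi * gS τ.im :=
    fun x y h h' => gD_pos τ hτ x y (mul_pos_of_neg_of_neg h h')
  have dpn : ∀ x y : ℝ, 0 < x → y < 0 → gD τ x y = 0 :=
    fun x y h h' => gD_neg τ x y (mul_neg_of_pos_of_neg h h')
  have dnp : ∀ x y : ℝ, x < 0 → 0 < y → gD τ x y = 0 :=
    fun x y h h' => gD_neg τ x y (mul_neg_of_neg_of_pos h h')
  have dz1 : ∀ y : ℝ, gD τ 0 y = τ.arg := fun y => gD_zero τ 0 y (Or.inl rfl)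
  have dz2 : ∀ x : ℝ, gD τ x 0 = τ.arg := fun x => gD_zero τ x 0 (Or.inr rfl)
  unfold gAlt
  generalize gS τ.im = s at *
  rcases lt_trichotomy x1 0 with h1 | rfl | h1 <;> rcases lt_trichotomy x2 0 with h2 | rfl | h2 <;>
  rcases lt_trichotomy y1 0 with h3 | rfl | h3 <;> rcases lt_trichotomy y2 0 with h4 | rfl | h4 <;>
  first
  | (exfalso; linarith)
  | (exfalso; simp at hc; done)
  | (simp only [*, dz1, dz2]; push_cast; ring)

theorem gAlt_corner_ll (τ : ℂ) (hτ : τ.im ≠ 0) (x2 y2 : ℝ) (hx : 0 < x2) (hy : 0 < y2) :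
    gAlt τ 0 x2 0 y2 = Real.pi * gS τ.im - τ.arg := by
  unfold gAlt
  rw [gD_pos τ hτ _ _ (mul_pos hx hy), gD_zero τ 0 _ (Or.inl rfl), gD_zero τ _ 0 (Or.inr rfl),
    gD_zero τ 0 _ (Or.inl rfl)]
  ring

theorem gAlt_corner_ur (τ : ℂ) (hτ : τ.im ≠ 0) (x1 y1 : ℝ) (hx : x1 < 0) (hy : y1 < 0) :
    gAlt τ x1 0 y1 0 = Real.pi * gS τ.im - τ.arg := by
  unfold gAlt
  rw [gD_pos τ hτ _ _ (mul_pos_of_neg_of_neg hx hy), gD_zero τ 0 _ (Or.inl rfl),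
    gD_zero τ _ 0 (Or.inr rfl), gD_zero τ 0 _ (Or.inl rfl)]
  ring

theorem g_lin_ne (c c' : ℂ) (h : (c / c').im ≠ 0) (x y : ℝ) (h0 : c * x - c' * y = 0) :
    x = 0 ∧ y = 0 := by
  have hc' : c' ≠ 0 := by rintro rfl; simp at h
  have e : c / c' * x = y := by field_simp; linear_combination h0
  have e1 := congrArg Complex.im e
  rw [mul_comm, Complex.im_ofReal_mul, Complex.ofReal_im] at e1
  have hx : x = 0 := by simpa [h] using e1
  refine ⟨hx, ?_⟩
  rw [hx] at e
  simpa using e.symm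

theorem g_diag_lim (g : ℝ → ℂ) (d : ℂ) (x : ℝ) (hg : HasStrictDerivAt g d x)
    (A : Set (ℝ × ℝ)) (hA : ∀ z ∈ A, z.1 ≠ z.2) :
    Tendsto (fun z : ℝ × ℝ => (g z.1 - g z.2) / ((z.1 - z.2 : ℝ) : ℂ)) (𝓝[A] (x, x)) (𝓝 d) := by
  have h1 := (hasStrictDerivAt_iff_hasStrictFDerivAt.mp hg).isLittleO
  have h2 : (fun z : ℝ × ℝ => g z.1 - g z.2 - ((z.1 - z.2 : ℝ) : ℂ) * d) =o[𝓝 (x, x)]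
      (fun z : ℝ × ℝ => ((z.1 - z.2 : ℝ) : ℂ)) := by
    have h1' := h1.norm_right
    refine Asymptotics.IsLittleO.of_norm_right ?_
    refine h1'.congr (fun z => ?_) (fun z => ?_)
    · simp
    · rw [Complex.norm_real]
  have h3 := (h2.mono (nhdsWithin_le_nhds (s := A))).tendsto_div_nhds_zero
  have h4 := h3.add_const d
  rw [zero_add] at h4
  refine h4.congr' ?_
  filter_upwards [self_mem_nhdsWithin] with z hz
  have : ((z.1 - z.2 : ℝ) : ℂ) ≠ 0 := by exact_mod_cast sub_ne_zero.mpr (hA z hz)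
  field_simp
  ring

theorem g_zero_lim (g : ℝ → ℂ) (c c' : ℂ) (p r : ℝ) (hp : HasStrictDerivAt g c p)
    (hr : HasStrictDerivAt g c' r) (h : (c / c').im ≠ 0) (hpr : g p = g r)
    (A : Set (ℝ × ℝ)) (hA : ∀ z ∈ A, z ≠ (p, r)) :
    Tendsto (fun z : ℝ × ℝ => (g z.1 - g z.2) / (c * ((z.1 - p : ℝ) : ℂ) - c' * ((z.2 - r : ℝ) : ℂ)))
      (𝓝[A] (p, r)) (𝓝 1) := by
  let L : ℝ × ℝ →ₗ[ℝ] ℂ :=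
    (LinearMap.toSpanSingleton ℝ ℂ c).comp (LinearMap.fst ℝ ℝ ℝ) -
      (LinearMap.toSpanSingleton ℝ ℂ c').comp (LinearMap.snd ℝ ℝ ℝ)
  have hL : ∀ z, L z = c * ((z.1 : ℝ) : ℂ) - c' * ((z.2 : ℝ) : ℂ) := by
    intro z; simp [L, mul_comm]
  have hker : LinearMap.ker L = ⊥ := by
    rw [LinearMap.ker_eq_bot']
    intro z hz
    rw [hL] at hz
    have := g_lin_ne c c' h _ _ hz
    exact Prod.ext this.1 this.2
  obtain ⟨K, hK0, hK⟩ := L.exists_antilipschitzWith hker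
  have hO : (fun z : ℝ × ℝ => z - (p, r)) =O[𝓝 (p, r)] (fun z => L (z - (p, r))) := by
    refine Asymptotics.IsBigO.of_bound K (Eventually.of_forall fun z => ?_)
    have := hK.le_mul_dist (z - (p, r)) 0
    simpa [dist_eq_norm] using this
  have o1 : (fun z : ℝ × ℝ => g z.1 - g p - (z.1 - p) • c) =o[𝓝 (p, r)]
      (fun z : ℝ × ℝ => z - (p, r)) := by
    have := hp.hasDerivAt.isLittleO.comp_tendsto (k := Prod.fst) (l' := 𝓝 (p, r))
      continuous_fst.continuousAt
    refine this.trans_isBigO ?_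
    refine Asymptotics.IsBigO.of_bound 1 (Eventually.of_forall fun z => ?_)
    rw [one_mul]
    exact norm_fst_le (z - (p, r))
  have o2 : (fun z : ℝ × ℝ => g z.2 - g r - (z.2 - r) • c') =o[𝓝 (p, r)]
      (fun z : ℝ × ℝ => z - (p, r)) := by
    have := hr.hasDerivAt.isLittleO.comp_tendsto (k := Prod.snd) (l' := 𝓝 (p, r))
      continuous_snd.continuousAt
    refine this.trans_isBigO ?_
    refine Asymptotics.IsBigO.of_bound 1 (Eventually.of_forall fun z => ?_)
    rw [one_mul]
    exact norm_snd_le (z - (p, r))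
  have o3 := ((o1.sub o2).trans_isBigO hO).mono (nhdsWithin_le_nhds (s := A))
  have h4 := o3.tendsto_div_nhds_zero.add_const 1
  rw [zero_add] at h4
  refine h4.congr' ?_
  filter_upwards [self_mem_nhdsWithin] with z hz
  have hne : L (z - (p, r)) ≠ 0 := by
    intro h0
    have : z - (p, r) = 0 := by
      have := LinearMap.ker_eq_bot'.mp hker _ h0
      exact this
    exact hA z hz (sub_eq_zero.mp this)
  have e : c * ((z.1 - p : ℝ) : ℂ) - c' * ((z.2 - r : ℝ) : ℂ) = L (z - (p, r)) := by
    rw [hL]; simp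
  rw [e]
  rw [div_add_one hne]
  congr 1
  rw [← e, hpr]
  simp only [Complex.real_smul]
  ring

theorem g_rect {κ : Type*} [Fintype κ] [DecidableEq κ] (g g' : ℝ → ℂ)
    (hg : ∀ x, HasStrictDerivAt g (g' x) x) (hper : ∀ x, g (x + 1) = g x)
    (hper' : ∀ x, g' (x + 1) = g' x) (hne : ∀ x, g' x ≠ 0)
    (p r : κ → ℝ) (hinj : ∀ k l, p k = p l → r k = r l → k = l)
    (him : ∀ k, (g' (p k) / g' (r k)).im ≠ 0) (hk : ∀ k, g (p k) = g (r k))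
    (a1 a2 b1 b2 : ℝ) (ha : a1 < a2) (hb : b1 < b2) (hga : g a1 = g a2) (hgb : g b1 = g b2)
    (hz : ∀ s ∈ Icc a1 a2, ∀ u ∈ Icc b1 b2, g s = g u →
      s = u ∨ s + 1 = u ∨ ∃ k, s = p k ∧ u = r k) :
    ∑ k, gAlt (g' (p k) / g' (r k)) (a1 - p k) (a2 - p k) (b1 - r k) (b2 - r k) = 0 := by
  set F : κ → ℝ × ℝ → ℂ := fun k z =>
    g' (p k) * ((z.1 - p k : ℝ) : ℂ) - g' (r k) * ((z.2 - r k : ℝ) : ℂ) with hF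
  set D : ℝ × ℝ → ℂ := fun z => ((z.1 - z.2 : ℝ) : ℂ) with hD
  set E : ℝ × ℝ → ℂ := fun z => ((z.1 - z.2 + 1 : ℝ) : ℂ) with hE
  set q : ℝ × ℝ → ℂ := fun z => (g z.1 - g z.2) / (D z * E z * ∏ k, F k z) with hq
  set K : Set (ℝ × ℝ) := Icc a1 a2 ×ˢ Icc b1 b2 with hKdef
  set A : Set (ℝ × ℝ) := {z | z ∈ K ∧ g z.1 ≠ g z.2} with hA
  have gc : Continuous g := continuous_iff_continuousAt.mpr fun x => (hg x).hasDerivAt.continuousAt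
  have Dc : Continuous D := by fun_prop
  have Ec : Continuous E := by fun_prop
  have Fc : ∀ k, Continuous (F k) := fun k => by fun_prop
  have Fne : ∀ k z, F k z = 0 → z.1 = p k ∧ z.2 = r k := by
    intro k z h
    have := g_lin_ne _ _ (him k) _ _ h
    exact ⟨sub_eq_zero.mp this.1, sub_eq_zero.mp this.2⟩
  have pne : ∀ k, p k ≠ r k := by
    intro k h
    apply him k
    rw [h, div_self (hne _)]; simp
  have pne1 : ∀ k, p k + 1 ≠ r k := by
    intro k h
    apply him k
    rw [← h, hper', div_self (hne _)]; simp
  have A1 : ∀ z ∈ A, z.1 ≠ z.2 := by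
    intro z hz h; exact hz.2 (by rw [h])
  have A2 : ∀ z ∈ A, z.1 + 1 ≠ z.2 := by
    intro z hz h; exact hz.2 (by rw [← h, hper])
  have A3 : ∀ k, ∀ z ∈ A, F k z ≠ 0 := by
    intro k z hz h; 
    obtain ⟨h1, h2⟩ := Fne k z h
    exact hz.2 (by rw [h1, h2, hk])
  have D0 : ∀ z, z.1 ≠ z.2 → D z ≠ 0 := by
    intro z h; simp only [hD]; exact_mod_cast sub_ne_zero.mpr h
  have E0 : ∀ z, z.1 + 1 ≠ z.2 → E z ≠ 0 := by
    intro z h; simp only [hE]; norm_cast; intro h'; apply h; linarith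
  have lim : ∀ z ∈ K, ∃ y, y ≠ 0 ∧ Tendsto q (𝓝[A] z) (𝓝 y) := by
    rintro ⟨s, u⟩ ⟨hs, hu⟩
    have tD : Tendsto D (𝓝[A] (s, u)) (𝓝 (D (s, u))) := (Dc.tendsto _).mono_left nhdsWithin_le_nhds
    have tE : Tendsto E (𝓝[A] (s, u)) (𝓝 (E (s, u))) := (Ec.tendsto _).mono_left nhdsWithin_le_nhds
    have tF : ∀ k, Tendsto (F k) (𝓝[A] (s, u)) (𝓝 (F k (s, u))) := fun k =>
      ((Fc k).tendsto _).mono_left nhdsWithin_le_nhds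
    have tG : Tendsto (fun z : ℝ × ℝ => g z.1 - g z.2) (𝓝[A] (s, u)) (𝓝 (g s - g u)) :=
      ((show Continuous (fun z : ℝ × ℝ => g z.1 - g z.2) by fun_prop).tendsto _).mono_left
        nhdsWithin_le_nhds
    by_cases h1 : s = u
    · subst h1
      have hF0 : ∀ k, F k (s, s) ≠ 0 := fun k h => by
        obtain ⟨h1, h2⟩ := Fne k _ h
        exact pne k (h1.symm.trans h2)
      have hE0 : E (s, s) ≠ 0 := E0 _ (by simp)
      refine ⟨g' s / (E (s, s) * ∏ k, F k (s, s)), div_ne_zero (hne _) (mul_ne_zero hE0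
        (Finset.prod_ne_zero_iff.mpr fun k _ => hF0 k)), ?_⟩
      have := (g_diag_lim g _ s (hg s) A A1).div
        (tE.mul (tendsto_finsetProd Finset.univ fun k _ => tF k)) (mul_ne_zero hE0
        (Finset.prod_ne_zero_iff.mpr fun k _ => hF0 k))
      refine this.congr fun z => ?_
      simp only [hq, hD, Pi.div_apply, div_div, mul_assoc]
    by_cases h2 : s + 1 = u
    · subst h2
      have hF0 : ∀ k, F k (s, s + 1) ≠ 0 := fun k h => by
        obtain ⟨h1, h2⟩ := Fne k _ h
        simp only at h1 h2
        exact pne1 k (by rw [← h1, h2])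
      have hD0 : D (s, s + 1) ≠ 0 := D0 _ h1
      have hP0 := (mul_ne_zero hD0 (Finset.prod_ne_zero_iff.mpr fun k (_ : k ∈ Finset.univ) => hF0 k))
      refine ⟨g' s / (D (s, s + 1) * ∏ k, F k (s, s + 1)), div_ne_zero (hne _) hP0, ?_⟩
      have key := g_diag_lim g _ s (hg s) {z | z.1 ≠ z.2} (fun z h => h)
      have tm : Tendsto (fun z : ℝ × ℝ => (z.1, z.2 - 1)) (𝓝[A] (s, s + 1))
          (𝓝[{z | z.1 ≠ z.2}] (s, s)) := by
        refine tendsto_nhdsWithin_iff.mpr ⟨?_, ?_⟩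
        · have : Continuous (fun z : ℝ × ℝ => (z.1, z.2 - 1)) := by fun_prop
          have := this.tendsto (s, s + 1)
          simp only [add_sub_cancel_right] at this
          exact this.mono_left nhdsWithin_le_nhds
        · filter_upwards [self_mem_nhdsWithin] with z hz
          have := A2 z hz
          change z.1 ≠ z.2 - 1
          intro h; apply this; linarith
      have := (key.comp tm).div (tD.mul (tendsto_finsetProd _ fun k _ => tF k)) hP0
      refine this.congr fun z => ?_
      have e1 : g (z.2 - 1) = g z.2 := by rw [← hper (z.2 - 1)]; simp
      have e2 : ((z.1 - (z.2 - 1) : ℝ) : ℂ) = E z := by simp only [hE]; congr 1; ring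
      simp only [hq, Function.comp, Pi.div_apply, e1, e2, div_div]
      ring_nf
    have hD0 : D (s, u) ≠ 0 := D0 _ h1
    have hE0 : E (s, u) ≠ 0 := E0 _ h2
    by_cases h3 : ∃ k, s = p k ∧ u = r k
    · obtain ⟨k, rfl, rfl⟩ := h3
      have hF0 : ∀ l ∈ Finset.univ.erase k, F l (p k, r k) ≠ 0 := fun l hl h => by
        obtain ⟨h1, h2⟩ := Fne l _ h
        exact (Finset.mem_erase.mp hl).1 (hinj _ _ h1 h2).symm
      have hP0 := mul_ne_zero (mul_ne_zero hD0 hE0) (Finset.prod_ne_zero_iff.mpr hF0)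
      refine ⟨1 / (D (p k, r k) * E (p k, r k) * ∏ l ∈ Finset.univ.erase k, F l (p k, r k)),
        div_ne_zero one_ne_zero hP0, ?_⟩
      have := (g_zero_lim g _ _ (p k) (r k) (hg _) (hg _) (him k) (hk k) A (fun z hz h => by
        apply A3 k z hz; rw [h]; simp [hF])).div
        ((tD.mul tE).mul (tendsto_finsetProd _ fun l _ => tF l)) hP0
      refine this.congr fun z => ?_
      simp only [hq, Pi.div_apply, div_div]
      rw [← Finset.mul_prod_erase Finset.univ (fun l => F l z) (Finset.mem_univ k)]
      simp only [hF]
      ring_nf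
    · have hgne : g s ≠ g u := fun h => by
        rcases hz s hs u hu h with h | h | h
        exacts [h1 h, h2 h, h3 h]
      have hF0 : ∀ k, F k (s, u) ≠ 0 := fun k h => h3 ⟨k, Fne k _ h⟩
      have hP0 := mul_ne_zero (mul_ne_zero hD0 hE0)
        (Finset.prod_ne_zero_iff.mpr fun k (_ : k ∈ Finset.univ) => hF0 k)
      exact ⟨_, div_ne_zero (sub_ne_zero.mpr hgne) hP0,
        tG.div ((tD.mul tE).mul (tendsto_finsetProd _ fun k _ => tF k)) hP0⟩
  have finV : ∀ s ∈ Icc a1 a2, ∀ u ∈ Icc b1 b2,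
      u ∉ ({s, s + 1} ∪ range r : Set ℝ) → (s, u) ∈ A := by
    intro s hs u hu hn
    refine ⟨⟨hs, hu⟩, fun h => hn ?_⟩
    rcases hz s hs u hu h with h | h | ⟨k, -, h⟩
    · left; left; exact h.symm
    · left; right; exact h.symm
    · right; exact ⟨k, h.symm⟩
  have fin : ∀ s : ℝ, ({s, s + 1} ∪ range r : Set ℝ).Finite := fun s =>
    ((finite_singleton _).insert _).union (finite_range r)
  have finH : ∀ s ∈ Icc a1 a2, ∀ u ∈ Icc b1 b2,
      s ∉ ({u, u - 1} ∪ range p : Set ℝ) → (s, u) ∈ A := by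
    intro s hs u hu hn
    refine ⟨⟨hs, hu⟩, fun h => hn ?_⟩
    rcases hz s hs u hu h with h | h | ⟨k, h, -⟩
    · left; left; exact h
    · left; right; rw [mem_singleton_iff]; linarith
    · right; exact ⟨k, h.symm⟩
  have finp : ∀ u : ℝ, ({u, u - 1} ∪ range p : Set ℝ).Finite := fun s =>
    ((finite_singleton _).insert _).union (finite_range p)
  have dense : K ⊆ closure A := by
    rintro ⟨s, u⟩ ⟨hs, hu⟩
    have h1 := g_dense hb _ (fin s) hu
    have h2 : Continuous (fun v : ℝ => (s, v)) := by fun_prop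
    have := mem_closure_image (f := fun v : ℝ => (s, v)) h2.continuousAt h1
    refine closure_mono ?_ this
    rintro _ ⟨v, ⟨hv, hv'⟩, rfl⟩
    exact finV s hs v hv hv'
  have hQc : ContinuousOn (extendFrom A q) K :=
    continuousOn_extendFrom dense fun z hz => by
      obtain ⟨y, -, h⟩ := lim z hz
      exact ⟨y, h⟩
  have hQ0 : ∀ z ∈ K, extendFrom A q z ≠ 0 := by
    intro z hz
    obtain ⟨y, hy, h⟩ := lim z hz
    rwa [extendFrom_eq (dense hz) h]
  have hQA : ∀ z ∈ A, extendFrom A q z = q z := by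
    intro z hz
    refine extendFrom_eq (subset_closure hz) ?_
    have : ContinuousAt q z := by
      have hP0 := mul_ne_zero (mul_ne_zero (D0 _ (A1 z hz)) (E0 _ (A2 z hz)))
        (Finset.prod_ne_zero_iff.mpr fun k (_ : k ∈ Finset.univ) => A3 k z hz)
      refine ContinuousAt.div (by fun_prop) ?_ hP0
      exact ((Dc.mul Ec).mul (continuous_finsetProd _ fun k _ => Fc k)).continuousAt
    exact this.tendsto.mono_left nhdsWithin_le_nhds
  have hKc : Convex ℝ K := (convex_Icc _ _).prod (convex_Icc _ _)
  obtain ⟨l, hl, hle⟩ := g_exists_log K hKc ⟨(a1, b1), ⟨le_rfl, ha.le⟩, ⟨le_rfl, hb.le⟩⟩ _ hQc hQ0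
  have eqA : ∀ z ∈ A, ((((z.1 - z.2) * (z.1 - z.2 + 1) : ℝ)) : ℂ) * Complex.exp (l z) *
      ∏ k, F k z = g z.1 - g z.2 := by
    intro z hz
    rw [hle z hz.1, hQA z hz]
    have hP0 := mul_ne_zero (mul_ne_zero (D0 _ (A1 z hz)) (E0 _ (A2 z hz)))
        (Finset.prod_ne_zero_iff.mpr fun k (_ : k ∈ Finset.univ) => A3 k z hz)
    rw [Complex.ofReal_mul]
    change D z * E z * q z * _ = _
    simp only [hq]
    rw [← mul_div_assoc, div_mul_eq_mul_div, div_eq_iff hP0]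
    ring
  have ha1 : a1 ∈ Icc a1 a2 := ⟨le_rfl, ha.le⟩
  have ha2 : a2 ∈ Icc a1 a2 := ⟨ha.le, le_rfl⟩
  have hb1 : b1 ∈ Icc b1 b2 := ⟨le_rfl, hb.le⟩
  have hb2 : b2 ∈ Icc b1 b2 := ⟨hb.le, le_rfl⟩
  have lV : ∀ s ∈ Icc a1 a2, ContinuousOn (fun u => l (s, u)) (Icc b1 b2) := fun s hs =>
    hl.comp (by fun_prop) fun u hu => ⟨hs, hu⟩
  have lH : ∀ u ∈ Icc b1 b2, ContinuousOn (fun s => l (s, u)) (Icc a1 a2) := fun u hu =>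
    hl.comp (by fun_prop) fun s hs => ⟨hs, hu⟩
  have edV := g_edge hb _ ((fin a1).union (fin a2)) (fun u => l (a2, u)) (fun u => l (a1, u))
    (lV a2 ha2) (lV a1 ha1) (fun k u => F k (a2, u)) (fun k u => F k (a1, u))
    (fun k u => gV (g' (p k) / g' (r k)) (a2 - p k) (u - r k))
    (fun k u => gV (g' (p k) / g' (r k)) (a1 - p k) (u - r k))
    (fun k => (gV_cont _ (him k) _).comp (by fun_prop))
    (fun k => (gV_cont _ (him k) _).comp (by fun_prop))
    (fun k => by
      obtain ⟨K, hK, h⟩ := gV_rep _ _ (him k) (a2 - p k)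
      exact ⟨K, hK, fun u => h (u - r k)⟩)
    (fun k => by
      obtain ⟨K, hK, h⟩ := gV_rep _ _ (him k) (a1 - p k)
      exact ⟨K, hK, fun u => h (u - r k)⟩)
    (by
      rintro u ⟨hu, hn⟩
      rw [mem_union, not_or] at hn
      have m1 := finV a1 ha1 u hu hn.1
      have m2 := finV a2 ha2 u hu hn.2
      refine ⟨(a2 - u) * (a2 - u + 1), (a1 - u) * (a1 - u + 1), ?_, ?_⟩
      · exact (eqA _ m2).trans (((eqA _ m1).trans (by simp only [hga])).symm)
      · exact fun h => sub_ne_zero.mpr m2.2 ((eqA _ m2).symm.trans h))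
  have edH := g_edge ha _ ((finp b1).union (finp b2)) (fun s => l (s, b2)) (fun s => l (s, b1))
    (lH b2 hb2) (lH b1 hb1) (fun k s => F k (s, b2)) (fun k s => F k (s, b1))
    (fun k s => gW (g' (p k) / g' (r k)) (s - p k) (b2 - r k))
    (fun k s => gW (g' (p k) / g' (r k)) (s - p k) (b1 - r k))
    (fun k => (gW_cont _ (him k) _).comp (by fun_prop))
    (fun k => (gW_cont _ (him k) _).comp (by fun_prop))
    (fun k => by
      obtain ⟨K, hK, h⟩ := gW_rep _ _ (him k) (b2 - r k)
      exact ⟨K, hK, fun u => h (u - p k)⟩)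
    (fun k => by
      obtain ⟨K, hK, h⟩ := gW_rep _ _ (him k) (b1 - r k)
      exact ⟨K, hK, fun u => h (u - p k)⟩)
    (by
      rintro s ⟨hs, hn⟩
      rw [mem_union, not_or] at hn
      have m1 := finH s hs b1 hb1 hn.1
      have m2 := finH s hs b2 hb2 hn.2
      refine ⟨(s - b2) * (s - b2 + 1), (s - b1) * (s - b1 + 1), ?_, ?_⟩
      · exact (eqA _ m2).trans (((eqA _ m1).trans (by simp only [hgb])).symm)
      · exact fun h => sub_ne_zero.mpr m2.2 ((eqA _ m2).symm.trans h))
  simp only [Finset.sum_sub_distrib] at edV edH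
  simp only [gAlt, gD, Finset.sum_sub_distrib, Finset.sum_add_distrib]
  linarith

end

section
open Topology Filter Set

noncomputable def gB (x y m : ℝ) : ℤ := if x < m ∧ m < y then 1 else 0

theorem gS_diff (x y m : ℝ) (h : x < y) :
    gS (y - m) - gS (x - m) = 2 * gB x y m + (if m = x ∨ m = y then 1 else 0) := by
  unfold gS gB
  simp only [sub_pos, sub_neg]
  split_ifs <;> first | rfl | (exfalso; grind)

theorem gB_mul_self (x y m : ℝ) : gB x y m * gB x y m = gB x y m := by
  unfold gB; split_ifs <;> simp

structure gBase {ι : Type*} (g g' : ℝ → ℂ) (τ : ι → Bool → ℝ) : Prop where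
  hg : ∀ x, HasStrictDerivAt g (g' x) x
  hper : ∀ x, g (x + 1) = g x
  hper' : ∀ x, g' (x + 1) = g' x
  hne : ∀ x, g' x ≠ 0
  hinj : ∀ c e d f, τ c e = τ d f → c = d ∧ e = f
  hlt : ∀ c, τ c false < τ c true
  hmem : ∀ c e, τ c e ∈ Ico (0 : ℝ) 1
  hcr : ∀ s ∈ Ico (0 : ℝ) 1, ∀ u ∈ Ico (0 : ℝ) 1, s ≠ u → g s = g u →
    ∃ c e, s = τ c e ∧ u = τ c (!e)
  heq : ∀ c, g (τ c false) = g (τ c true)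
  him : ∀ c, (g' (τ c false) / g' (τ c true)).im ≠ 0

theorem gS_inv (z : ℂ) : gS (z⁻¹).im = - gS z.im := by
  rw [Complex.inv_im]
  by_cases hz : z = 0
  · simp [hz, gS]
  have h : 0 < Complex.normSq z := Complex.normSq_pos.mpr hz
  unfold gS
  rcases lt_trichotomy z.im 0 with h1 | h1 | h1
  · have : 0 < -z.im / Complex.normSq z := by apply div_pos <;> linarith
    simp [this, h1, h1.not_gt]
  · simp [h1]
  · have : -z.im / Complex.normSq z < 0 := by apply div_neg_of_neg_of_pos <;> linarith
    simp [this, h1, this.not_gt]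

theorem gS_im (z : ℂ) (hz : z.im ≠ 0) : gS z.im = 1 ∨ gS z.im = -1 := by
  unfold gS
  rcases lt_or_gt_of_ne hz with h | h
  · right; simp [h, h.not_gt]
  · left; simp [h]

set_option linter.unusedSectionVars false
set_option linter.unusedVariables false
section
variable {ι : Type*} [Fintype ι] [DecidableEq ι] {g g' : ℝ → ℂ} {τ : ι → Bool → ℝ}

noncomputable def gSig (g' : ℝ → ℂ) (τ : ι → Bool → ℝ) (c : ι) : ℤ :=
  gS (g' (τ c false) / g' (τ c true)).im

theorem gBase.him' (H : gBase g g' τ) (c : ι) (e : Bool) :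
    (g' (τ c e) / g' (τ c (!e))).im ≠ 0 := by
  cases e
  · exact H.him c
  · have h := H.him c
    simp only [Bool.not_true]
    rw [← inv_div, Complex.inv_im]
    refine div_ne_zero (neg_ne_zero.mpr h) ?_
    intro h0
    rw [Complex.normSq_eq_zero] at h0
    rw [h0] at h; simp at h

theorem gBase.heq' (H : gBase g g' τ) (c : ι) (e : Bool) : g (τ c e) = g (τ c (!e)) := by
  cases e
  · exact H.heq c
  · exact (H.heq c).symm

theorem gBase.sig (H : gBase g g' τ) (c : ι) :
    gS (g' (τ c true) / g' (τ c false)).im = - gSig g' τ c := by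
  rw [gSig, ← gS_inv, inv_div]

theorem gBase.rectN (H : gBase g g' τ) (a b : ι) (hab : a ≠ b) :
    ∑ c, gSig g' τ c *
      ((2 * gB (τ a false) (τ a true) (τ c false) + if c = a then 1 else 0) *
       (2 * gB (τ b false) (τ b true) (τ c true) + if c = b then 1 else 0) -
       (2 * gB (τ a false) (τ a true) (τ c true) + if c = a then 1 else 0) *
       (2 * gB (τ b false) (τ b true) (τ c false) + if c = b then 1 else 0)) = 0 := by
  have key := g_rect (κ := ι × Bool) g g' H.hg H.hper H.hper' H.hne (fun k => τ k.1 k.2)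
    (fun k => τ k.1 (!k.2)) (fun k l h _ => by
      obtain ⟨h1, h2⟩ := H.hinj _ _ _ _ h; exact Prod.ext h1 h2) (fun k => H.him' _ _)
    (fun k => H.heq' _ _) _ _ _ _ (H.hlt a) (H.hlt b) (H.heq a) (H.heq b) (by
      rintro s ⟨hs1, hs2⟩ u ⟨hu1, hu2⟩ h
      by_cases hsu : s = u
      · exact Or.inl hsu
      · obtain ⟨c, e, h1, h2⟩ := H.hcr s ⟨(H.hmem a false).1.trans hs1, hs2.trans_lt (H.hmem a true).2⟩
          u ⟨(H.hmem b false).1.trans hu1, hu2.trans_lt (H.hmem b true).2⟩ hsu h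
        exact Or.inr (Or.inr ⟨(c, e), h1, h2⟩))
  have hd : ∀ c d e, gS (τ d true - τ c e) - gS (τ d false - τ c e) =
      2 * gB (τ d false) (τ d true) (τ c e) + if c = d then 1 else 0 := by
    intro c d e
    rw [gS_diff _ _ _ (H.hlt d)]
    congr 1
    have : (τ c e = τ d false ∨ τ c e = τ d true) ↔ c = d := by
      constructor
      · rintro (h | h) <;> exact (H.hinj _ _ _ _ h).1
      · rintro rfl; cases e <;> simp
    simp only [this]
  have e1 : ∀ k : ι × Bool, gAlt (g' (τ k.1 k.2) / g' (τ k.1 !k.2)) (τ a false - τ k.1 k.2)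
      (τ a true - τ k.1 k.2) (τ b false - τ k.1 !k.2) (τ b true - τ k.1 !k.2) =
      Real.pi / 2 * ((gS (g' (τ k.1 k.2) / g' (τ k.1 !k.2)).im *
      (2 * gB (τ a false) (τ a true) (τ k.1 k.2) + if k.1 = a then 1 else 0) *
       (2 * gB (τ b false) (τ b true) (τ k.1 !k.2) + if k.1 = b then 1 else 0) : ℤ) : ℝ) := by
    intro k
    rw [gAlt_noncorner _ (H.him' _ _) _ _ _ _ (by have := H.hlt a; linarith)
      (by have := H.hlt b; linarith), hd, hd]
    rintro ⟨h1, h2⟩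
    have h1' : a = k.1 := by
      rcases h1 with h1 | h1 <;> exact (H.hinj _ _ _ _ (sub_eq_zero.mp h1)).1
    have h2' : b = k.1 := by
      rcases h2 with h2 | h2 <;> exact (H.hinj _ _ _ _ (sub_eq_zero.mp h2)).1
    exact hab (h1'.trans h2'.symm)
  rw [Finset.sum_congr rfl (fun k _ => e1 k), ← Finset.mul_sum] at key
  have hpi : Real.pi / 2 ≠ 0 := by positivity
  have key2 := (mul_eq_zero.mp key).resolve_left hpi
  rw [← Int.cast_sum] at key2
  have key3 := Int.cast_eq_zero.mp key2
  rw [Fintype.sum_prod_type] at key3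
  simp only [Fintype.sum_bool, Bool.not_true, Bool.not_false, H.sig] at key3
  refine Eq.trans ?_ key3
  refine Finset.sum_congr rfl fun c _ => ?_
  have s1 : gS (g' (τ c false) / g' (τ c true)).im = gSig g' τ c := rfl
  rw [s1]
  ring

theorem gBase.rectE (H : gBase g g' τ) (a : ι) :
    ∑ c, (if c = a then 0 else gSig g' τ c *
      (gB (τ a false) (τ a true) (τ c false) - gB (τ a false) (τ a true) (τ c true))) = 0 := by
  have hf : ∀ f : Bool, ∀ x, g (x + (if f then 1 else 0 : ℝ)) = g x := by
    intro f x; cases f <;> simp [H.hper]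
  have hf' : ∀ f : Bool, ∀ x, g' (x + (if f then 1 else 0 : ℝ)) = g' x := by
    intro f x; cases f <;> simp [H.hper']
  have ma0 := H.hmem a false
  have ma1 := H.hmem a true
  have hlt := H.hlt a
  have key := g_rect (κ := (ι × Bool) × Bool) g g' H.hg H.hper H.hper' H.hne
    (fun k => τ k.1.1 k.1.2)
    (fun k => τ k.1.1 (!k.1.2) + (if k.2 then 1 else 0 : ℝ)) (by
      rintro ⟨⟨c, e⟩, f⟩ ⟨⟨d, e'⟩, f'⟩ h h'
      obtain ⟨rfl, rfl⟩ := H.hinj _ _ _ _ h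
      cases f <;> cases f' <;> simp at h' ⊢)
    (fun k => by rw [hf']; exact H.him' _ _)
    (fun k => by rw [hf]; exact H.heq' _ _) (τ a false) (τ a true) (τ a true) (τ a false + 1)
    hlt (by linarith [ma1.2, ma0.1]) (H.heq a)
    (by rw [H.hper]; exact (H.heq a).symm) (by
      rintro s ⟨hs1, hs2⟩ u ⟨hu1, hu2⟩ h
      have hs : s ∈ Ico (0 : ℝ) 1 := ⟨ma0.1.trans hs1, hs2.trans_lt ma1.2⟩
      by_cases hsu : s = u
      · exact Or.inl hsu
      by_cases hsu1 : s + 1 = u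
      · exact Or.inr (Or.inl hsu1)
      right; right
      by_cases hu : u < 1
      · obtain ⟨c, e, h1, h2⟩ := H.hcr s hs u ⟨by linarith [ma1.1], hu⟩ hsu h
        exact ⟨((c, e), false), h1, by simpa using h2⟩
      · obtain ⟨c, e, h1, h2⟩ := H.hcr s hs (u - 1) ⟨by linarith, by linarith [ma0.2]⟩
          (fun h => hsu1 (by linarith)) (by rw [h, ← H.hper (u - 1)]; simp)
        exact ⟨((c, e), true), h1, by simp only [if_true]; linarith⟩)
  have hc : ∀ c, ∑ e : Bool, ∑ f : Bool,
      gAlt (g' (τ c e) / g' (τ c (!e) + (if f then 1 else 0 : ℝ)))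
        (τ a false - τ c e) (τ a true - τ c e) (τ a true - (τ c (!e) + (if f then 1 else 0 : ℝ)))
        (τ a false + 1 - (τ c (!e) + (if f then 1 else 0 : ℝ))) =
      Real.pi * 2 * ((if c = a then 0 else gSig g' τ c *
      (gB (τ a false) (τ a true) (τ c false) - gB (τ a false) (τ a true) (τ c true)) : ℤ) : ℝ) := by
    intro c
    have m0 := H.hmem c false
    have m1 := H.hmem c true
    simp only [hf']
    by_cases hca : c = a
    · subst hca
      simp only [Fintype.sum_bool, Bool.not_true, Bool.not_false, if_true, sub_self,
        add_zero, Bool.false_eq_true, if_false, Int.cast_zero, mul_zero, add_sub_add_right_eq_sub]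
      have hit := H.him' c true
      rw [Bool.not_true] at hit
      rw [gAlt_corner_ll _ (H.him c) _ _ (by linarith) (by linarith [m0.1, m1.2]),
        gAlt_corner_ur _ hit _ _ (by linarith) (by linarith [m0.1, m1.2]),
        gAlt_noncorner _ hit _ _ _ _ (by linarith) (by linarith [m0.1, m1.2]),
        gAlt_noncorner _ (H.him c) _ _ _ _ (by linarith) (by linarith [m0.1, m1.2])]
      · have p1 : gS (τ c true - τ c false) = 1 := by simp [gS, hlt]
        have p2 : gS (τ c false + 1 - τ c false) = 1 := by simp [gS]
        have p3 : gS (τ c true - (τ c true + 1)) = -1 := by simp [gS]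
        have p4 : gS (τ c false - τ c true) = -1 := by simp [gS, hlt, hlt.not_gt]
        rw [p1, p2, p3, p4, H.sig]
        have harg : (g' (τ c true) / g' (τ c false)).arg = - (g' (τ c false) / g' (τ c true)).arg := by
          rw [← inv_div, Complex.arg_inv, if_neg]
          intro h
          rw [Complex.arg_eq_pi_iff] at h
          exact H.him c h.2
        rw [harg]
        simp only [gSig]
        push_cast
        ring
      · rintro ⟨-, h⟩; rcases h with h | h <;> linarith
      · rintro ⟨-, h⟩; rcases h with h | h <;> linarith [m0.1, m1.2]
    · have ne : ∀ e f, τ c e ≠ τ a f := fun e f h => hca (H.hinj _ _ _ _ h).1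
      have nc : ∀ e, ¬ (τ a false - τ c e = 0 ∨ τ a true - τ c e = 0) := by
        rintro e (h | h) <;> exact ne _ _ (sub_eq_zero.mp h).symm
      have hx : ∀ e, gS (τ a true - τ c e) - gS (τ a false - τ c e) =
          2 * gB (τ a false) (τ a true) (τ c e) := by
        intro e
        rw [gS_diff _ _ _ hlt]; simp [ne]
      have hy : ∀ e, (gS (τ a false + 1 - (τ c e + 0)) - gS (τ a true - (τ c e + 0))) +
          (gS (τ a false + 1 - (τ c e + 1)) - gS (τ a true - (τ c e + 1))) =
          2 * (1 - gB (τ a false) (τ a true) (τ c e)) := by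
        intro e
        have m := H.hmem c e
        have q1 : gS (τ a false + 1 - (τ c e + 0)) = 1 := by
          have : 0 < τ a false + 1 - (τ c e + 0) := by linarith [m.2, ma0.1]
          simp only [gS, this, if_true]
        have q2 : gS (τ a true - (τ c e + 1)) = -1 := by
          have : τ a true - (τ c e + 1) < 0 := by linarith [m.1, ma1.2]
          simp only [gS, this, if_true, this.not_gt, if_false]
        have := hx e
        rw [q1, q2, add_zero, add_sub_add_right_eq_sub]
        linarith
      have hlt2 : τ a true < τ a false + 1 := by linarith [ma0.1, ma1.2]
      have nn : ∀ e f, gAlt (g' (τ c e) / g' (τ c (!e)))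
        (τ a false - τ c e) (τ a true - τ c e) (τ a true - (τ c (!e) + f))
        (τ a false + 1 - (τ c (!e) + f)) = Real.pi / 2 * ((gS (g' (τ c e) / g' (τ c (!e))).im *
          (2 * gB (τ a false) (τ a true) (τ c e)) *
          (gS (τ a false + 1 - (τ c (!e) + f)) - gS (τ a true - (τ c (!e) + f))) : ℤ) : ℝ) := by
        intro e f
        rw [gAlt_noncorner _ (H.him' c e) _ _ _ _ (by linarith) (by linarith)
          (fun h => nc e h.1), hx]
      simp only [nn]
      rw [if_neg hca]
      have y0 := hy false
      have y1 := hy true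
      simp only [Fintype.sum_bool, Bool.not_true, Bool.not_false, if_true,
        Bool.false_eq_true, if_false]
      have s1 : gS (g' (τ c false) / g' (τ c true)).im = gSig g' τ c := rfl
      rw [H.sig, s1]
      rw [← mul_add, ← mul_add, ← mul_add]
      have : Real.pi * 2 = Real.pi / 2 * 4 := by ring
      rw [this, mul_assoc (Real.pi / 2)]
      congr 1
      norm_cast
      linear_combination (-gSig g' τ c * (2 * gB (τ a false) (τ a true) (τ c true))) * y0 +
        (gSig g' τ c * (2 * gB (τ a false) (τ a true) (τ c false))) * y1
  rw [Fintype.sum_prod_type, Fintype.sum_prod_type] at key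
  rw [Finset.sum_congr rfl (fun c _ => hc c), ← Finset.mul_sum] at key
  have hpi : Real.pi * 2 ≠ 0 := by positivity
  have key2 := (mul_eq_zero.mp key).resolve_left hpi
  rw [← Int.cast_sum] at key2
  exact_mod_cast key2
end

end

section
set_option linter.unusedVariables false

structure gInv {ι R : Type*} [DecidableEq ι] [CommRing R] (U : Finset ι) (u : ι → Bool → ι → R)
    (h : ι → Bool → R) : Prop where
  hH : ∀ c ∈ U, h c false = h c true
  hE : ∀ a, ∑ c ∈ U, (u c false a + u c true a) + h a false + h a true = 0
  hN : ∀ a b, a ≠ b → ∑ c ∈ U, (u c false a * u c true b + u c true a * u c false b) +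
    (h a false * u a false b + h a true * u a true b) +
    (h b false * u b false a + h b true * u b true a) + (u b false a + u b true a) = 0

structure gGeo {ι R : Type*} [CommRing R] (u : ι → Bool → ι → R) : Prop where
  idem : ∀ c e a, u c e a * u c e a = u c e a
  self : ∀ a e, u a e a = 0
  sym : ∀ a b, u b false a + u b true a = u a false b + u a true b
  tri : ∀ a b c, a ≠ b → a ≠ c → b ≠ c →
    (u a false b * u a false c + u a true b * u a true c) +
    (u b false a * u b false c + u b true a * u b true c) +
    (u c false a * u c false b + u c true a * u c true b) = 0

def gH' {ι R : Type*} [DecidableEq ι] [CommRing R] (U : Finset ι) (u : ι → Bool → ι → R)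
    (h : ι → Bool → R) (p : ι) (a : ι) (e : Bool) : R :=
  if a = p then h a e + 1 else if a ∈ U then
    h a e + (u a false p + u a true p) + u a false p * u a true p else h a e + u a e p

theorem g_alg1 {R : Type*} [CommRing R] (h2 : (2 : R) = 0) (k l s t v w β : R)
    (hs : s * s = s) (ht : t * t = t) :
    (k + (s + t) + s * t) * (v + β * s) + (l + (s + t) + s * t) * (w + β * t) +
      (s + t) * (s * w + t * v) =
    k * (v + β * s) + l * (w + β * t) + (s * v + t * w) + (s + t) * β := by
  grind

theorem g_alg2 {R : Type*} [CommRing R] (h2 : (2 : R) = 0) (k l s t v w β : R)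
    (hs : s * s = s) (ht : t * t = t) :
    (k + s) * (v + β * s) + (l + t) * (w + β * t) + 0 =
    k * (v + β * s) + l * (w + β * t) + (s * v + t * w) + (s + t) * β := by
  grind

theorem gInv.step {ι R : Type*} [DecidableEq ι] [CommRing R] (h2 : (2 : R) = 0) {U : Finset ι}
    {u : ι → Bool → ι → R} {h : ι → Bool → R} (I : gInv U u h) (G : gGeo u) (p : ι) (hp : p ∈ U)
    (u' : ι → Bool → ι → R) (hu0 : ∀ a e, u' a e a = 0) (hup : ∀ c e, u' c e p = u c e p)
    (hu : ∀ c e a, c ≠ a → a ≠ p → u' c e a = u c e a + (u a false p + u a true p) * u c e p) :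
    gInv (U.erase p) u' (gH' U u h p) := by
  have esum : ∀ f : ι → R, ∑ c ∈ U.erase p, f c = ∑ c ∈ U, f c - f p := by
    intro f; rw [← Finset.add_sum_erase U f hp]; ring
  have isum : ∀ (a : ι) (x : R), a ≠ p →
      ∑ c ∈ U.erase p, (if c = a then x else 0) = if a ∈ U then x else 0 := by
    intro a x ha
    rw [Finset.sum_ite_eq' (U.erase p)]
    simp [ha]
  have hpp := I.hH p hp
  have N1 : ∀ a, a ≠ p → ∑ c ∈ U.erase p, (u' c false a * u' c true p + u' c true a * u' c false p) +
    (gH' U u h p a false * u' a false p + gH' U u h p a true * u' a true p) +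
    (gH' U u h p p false * u' p false a + gH' U u h p p true * u' p true a) +
    (u' p false a + u' p true a) = 0 := by
    intro a ha
    have n := I.hN a p ha
    have s := G.sym a p
    have e1 : ∑ c ∈ U.erase p, (u' c false a * u' c true p + u' c true a * u' c false p) =
        ∑ c ∈ U, (u c false a * u c true p + u c true a * u c false p) := by
      have : ∀ c ∈ U.erase p, (u' c false a * u' c true p + u' c true a * u' c false p) =
          (u c false a * u c true p + u c true a * u c false p) := by
        intro c _
        by_cases hc : c = a
        · subst hc; simp [hu0, G.self]
        · rw [hup, hup, hu _ _ _ hc ha, hu _ _ _ hc ha]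
          linear_combination (u a false p + u a true p) * u c false p * u c true p * h2
      rw [Finset.sum_congr rfl this, esum]
      simp [G.self]
    rw [e1]
    have i1 := G.idem a false p
    have i2 := G.idem a true p
    simp only [hup, hu _ _ _ ha.symm ha, gH', G.self, if_neg ha, if_true, mul_zero, add_zero]
    split_ifs <;> grind
  refine ⟨?_, ?_, ?_⟩
  · intro c hc
    obtain ⟨h1, h3⟩ := Finset.mem_erase.mp hc
    simp [gH', h1, h3, I.hH c h3]
  · intro a
    by_cases ha : a = p
    · subst ha
      rw [esum]
      have := I.hE a
      simp only [hup, G.self, gH', if_true]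
      grind
    · have e1 : ∀ c ∈ U.erase p, u' c false a + u' c true a =
          (u c false a + u c true a) + (u a false p + u a true p) * (u c false p + u c true p) +
          (if c = a then -((u a false p + u a true p) * (u a false p + u a true p)) else 0) := by
        intro c _
        by_cases hc : c = a
        · subst hc; simp [hu0, G.self]
        · rw [hu _ _ _ hc ha, hu _ _ _ hc ha, if_neg hc]; ring
      rw [Finset.sum_congr rfl e1, Finset.sum_add_distrib, Finset.sum_add_distrib,
        ← Finset.mul_sum, isum _ _ ha, esum, esum]
      have Ea := I.hE a
      have Ep := I.hE p
      have s := G.sym a p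
      have i1 := G.idem a false p
      have i2 := G.idem a true p
      simp only [gH', G.self, if_neg ha]
      by_cases haU : a ∈ U
      · have := I.hH a haU
        simp only [if_pos haU]; grind
      · simp only [if_neg haU]; grind
  · intro a b hab
    by_cases ha : a = p
    · subst ha
      have n := N1 b hab.symm
      have s : u' b false a + u' b true a = u' a false b + u' a true b := by
        rw [hup, hup, hu _ _ _ hab hab.symm, hu _ _ _ hab hab.symm, G.self, G.self, G.sym]; ring
      rw [s]
      rw [← n]
      have : ∀ c, u' c false a * u' c true b + u' c true a * u' c false b =
        u' c false b * u' c true a + u' c true b * u' c false a := fun c => by ring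
      simp only [this]
      ring
    by_cases hb : b = p
    · subst hb
      exact N1 a ha
    have e1 : ∀ c ∈ U.erase p, (u' c false a * u' c true b + u' c true a * u' c false b) =
        (u c false a * u c true b + u c true a * u c false b) +
        (u a false p + u a true p) * (u c false p * u c true b + u c true p * u c false b) +
        (u b false p + u b true p) * (u c false a * u c true p + u c true a * u c false p) +
        (if c = a then (u a false p + u a true p) *
          (u a false p * u a true b + u a true p * u a false b) else 0) +
        (if c = b then (u b false p + u b true p) *
          (u b false p * u b true a + u b true p * u b false a) else 0) := by
      intro c _
      by_cases hca : c = a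
      · subst hca
        simp only [hu0, G.self, if_true, if_neg hab]
        grind
      by_cases hcb : c = b
      · subst hcb
        simp only [hu0, G.self, if_true, if_neg hca]
        grind
      rw [hu _ _ _ hca ha, hu _ _ _ hca ha, hu _ _ _ hcb hb, hu _ _ _ hcb hb, if_neg hca, if_neg hcb]
      linear_combination (u a false p + u a true p) * (u b false p + u b true p) *
        u c false p * u c true p * h2
    rw [Finset.sum_congr rfl e1]
    simp only [Finset.sum_add_distrib]
    rw [isum _ _ ha, isum _ _ hb, ← Finset.mul_sum, ← Finset.mul_sum]
    have nab := I.hN a b hab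
    have npb := I.hN p b (Ne.symm hb)
    have nap := I.hN a p ha
    simp only [esum, G.self]
    rw [hu _ _ _ hab hb, hu _ _ _ hab hb, hu _ _ _ hab.symm ha, hu _ _ _ hab.symm ha]
    have t := G.tri a b p hab ha hb
    have sa := G.sym a p
    have sb := G.sym b p
    have sab := G.sym a b
    have ka : gH' U u h p a false * (u a false b + (u b false p + u b true p) * u a false p) +
        gH' U u h p a true * (u a true b + (u b false p + u b true p) * u a true p) +
        (if a ∈ U then (u a false p + u a true p) *
          (u a false p * u a true b + u a true p * u a false b) else 0) =
        h a false * (u a false b + (u b false p + u b true p) * u a false p) +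
        h a true * (u a true b + (u b false p + u b true p) * u a true p) +
        (u a false p * u a false b + u a true p * u a true b) +
        (u a false p + u a true p) * (u b false p + u b true p) := by
      have i1 := G.idem a false p
      have i2 := G.idem a true p
      simp only [gH', if_neg ha]
      split_ifs
      · exact g_alg1 h2 _ _ _ _ _ _ _ i1 i2
      · exact g_alg2 h2 _ _ _ _ _ _ _ i1 i2
    have kb : gH' U u h p b false * (u b false a + (u a false p + u a true p) * u b false p) +
        gH' U u h p b true * (u b true a + (u a false p + u a true p) * u b true p) +
        (if b ∈ U then (u b false p + u b true p) *
          (u b false p * u b true a + u b true p * u b false a) else 0) =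
        h b false * (u b false a + (u a false p + u a true p) * u b false p) +
        h b true * (u b true a + (u a false p + u a true p) * u b true p) +
        (u b false p * u b false a + u b true p * u b true a) +
        (u b false p + u b true p) * (u a false p + u a true p) := by
      have i1 := G.idem b false p
      have i2 := G.idem b true p
      simp only [gH', if_neg hb]
      split_ifs
      · exact g_alg1 h2 _ _ _ _ _ _ _ i1 i2
      · exact g_alg2 h2 _ _ _ _ _ _ _ i1 i2
    simp only [Finset.sum_add_distrib] at nab npb nap
    set Sa := (if a ∈ U then (u a false p + u a true p) *
          (u a false p * u a true b + u a true p * u a false b) else 0)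
    set Sb := (if b ∈ U then (u b false p + u b true p) *
          (u b false p * u b true a + u b true p * u b false a) else 0)
    set α := u a false p + u a true p with hα
    set β := u b false p + u b true p with hβ
    have tp : u p false a * u p true b + u p true a * u p false b =
        α * β - (u p false a * u p false b + u p true a * u p true b) := by
      rw [← sa, ← sb]; ring
    simp only [Finset.sum_add_distrib]
    linear_combination (norm := skip) ka + kb + nab + α * npb + β * nap + t - tp
    ring_nf
    grind

end

section
set_option linter.unusedVariables false

def gU (x y m : ℕ) : ZMod 2 := if (x < m ∧ m < y) ∨ (y < m ∧ m < x) then 1 else 0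

def gRho (x y k : ℕ) : ℕ := if (x < k ∧ k < y) ∨ (y < k ∧ k < x) then x + y - k else k

theorem gRho_rho (x y k : ℕ) : gRho x y (gRho x y k) = k := by
  unfold gRho; split_ifs <;> omega

theorem gRho_inj (x y k l : ℕ) (h : gRho x y k = gRho x y l) : k = l := by
  rw [← gRho_rho x y k, h, gRho_rho]

theorem gU_rho (x y k : ℕ) : gU x y (gRho x y k) = gU x y k := by
  unfold gU gRho; split_ifs <;> first | rfl | omega

theorem gU_idem (x y k : ℕ) : gU x y k * gU x y k = gU x y k := by
  unfold gU; split_ifs <;> rfl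

theorem gU_left (x y : ℕ) : gU x y x = 0 := by
  unfold gU; split_ifs <;> first | rfl | omega

theorem gU_right (x y : ℕ) : gU x y y = 0 := by
  unfold gU; split_ifs <;> first | rfl | omega

def gL (x y : ℕ) : ZMod 2 := if x < y then 1 else 0

theorem gU_gL (x y m : ℕ) (h1 : m ≠ x) (h2 : m ≠ y) : gU x y m = gL x m + gL y m := by
  unfold gU gL; split_ifs <;> first | rfl | omega

theorem gL_swap (x y : ℕ) (h : x ≠ y) : gL x y = 1 + gL y x := by
  unfold gL; split_ifs <;> first | rfl | omega

theorem gL_cyc (x y z : ℕ) (h1 : x ≠ y) (h2 : x ≠ z) (h3 : y ≠ z) :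
    1 + gL x y + gL y z + gL z x + gL x y * gL y z + gL y z * gL z x + gL z x * gL x y = 0 := by
  unfold gL; split_ifs <;> first | rfl | omega

theorem gU_refl (x y a b m : ℕ) (hxy : x ≠ y) (hax : a ≠ x) (hay : a ≠ y) (hbx : b ≠ x)
    (hby : b ≠ y) (hma : m ≠ a) (hmb : m ≠ b) :
    gU (gRho x y a) (gRho x y b) (gRho x y m) =
      gU a b m + (gU x y a + gU x y b) * gU x y m := by
  wlog h : x < y generalizing x y
  · have e1 : ∀ k, gRho x y k = gRho y x k := by
      intro k; unfold gRho; split_ifs <;> omega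
    have e2 : ∀ k, gU x y k = gU y x k := by
      intro k; unfold gU; split_ifs <;> first | rfl | omega
    simp only [e1, e2]
    exact this y x hxy.symm hay hax hby hbx (by omega)
  have e1 : ∀ k, gRho x y k = if x < k ∧ k < y then x + y - k else k := by
    intro k; unfold gRho; split_ifs <;> omega
  have e2 : ∀ k, gU x y k = if x < k ∧ k < y then 1 else 0 := by
    intro k; unfold gU; split_ifs <;> first | rfl | omega
  have h2 : (1 + 1 : ZMod 2) = 0 := rfl
  simp only [e1, e2]
  by_cases ha : x < a ∧ a < y <;> by_cases hb : x < b ∧ b < y <;> by_cases hm : x < m ∧ m < y <;>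
    simp only [ha, hb, hm, if_true, if_false, and_self] <;> unfold gU <;> split_ifs <;>
    first | rfl | omega

theorem g_tri {R : Type*} [CommRing R] (h2 : (2 : R) = 0) (L M N : Bool → Bool → R)
  (h : ∀ i j k, 1 + L i j + M j k + N k i + L i j * M j k + M j k * N k i + N k i * L i j = 0) :
  (L false false + L true false) * (M false false + M false true) +
  (L false true + L true true) * (M true false + M true true) +
  (M false false + M true false) * (N false false + N false true) +
  (M false true + M true true) * (N true false + N true true) +
  (N false false + N true false) * (L false false + L false true) +
  (N false true + N true true) * (L true false + L true true) = 0 := by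
  linear_combination h false false false + h false false true + h false true false +
    h false true true + h true false false + h true false true + h true true false +
    h true true true - h2 * ((L false false + L false true + L true false + L true true + 
    M false false + M false true + M true false + M true true + 
    N false false + N false true + N true false + N true true) + 4)

theorem gGeo_pos {ι : Type*} (pos : ι → Bool → ℕ)
    (hinj : ∀ c e d f, pos c e = pos d f → c = d ∧ e = f) :
    gGeo (fun c e a => gU (pos a false) (pos a true) (pos c e)) := by
  have hne : ∀ c e d f, c ≠ d → pos c e ≠ pos d f := fun c e d f h h' => h (hinj _ _ _ _ h').1
  have h2 : (2 : ZMod 2) = 0 := rfl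
  refine ⟨fun c e a => gU_idem _ _ _, ?_, ?_, ?_⟩
  · intro a e
    cases e
    · exact gU_left _ _
    · exact gU_right _ _
  · intro a b
    by_cases hab : a = b
    · subst hab; rfl
    have e : ∀ x y z w : ℕ, z ≠ x → z ≠ y → w ≠ x → w ≠ y → gU x y z + gU x y w = gU z w x + gU z w y := by
      intro x y z w h1 h2' h3 h4
      rw [gU_gL _ _ _ h1 h2', gU_gL _ _ _ h3 h4, gU_gL _ _ _ h1.symm h3.symm,
        gU_gL _ _ _ h2'.symm h4.symm, gL_swap x z h1.symm, gL_swap x w h3.symm,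
        gL_swap y z h2'.symm, gL_swap y w h4.symm]
      linear_combination 2 * h2
    exact e _ _ _ _ (hne _ _ _ _ (Ne.symm hab)) (hne _ _ _ _ (Ne.symm hab))
      (hne _ _ _ _ (Ne.symm hab)) (hne _ _ _ _ (Ne.symm hab))
  · intro a b c hab hac hbc
    have hba := hab.symm
    have hca := hac.symm
    have hcb := hbc.symm
    have key := g_tri h2 (fun i j => gL (pos a i) (pos b j)) (fun i j => gL (pos b i) (pos c j))
      (fun i j => gL (pos c i) (pos a j)) (fun i j k => gL_cyc _ _ _ (hne _ _ _ _ hab)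
        (hne _ _ _ _ hac) (hne _ _ _ _ hbc))
    have s : ∀ d e x f g, d ≠ e → gU (pos d f) (pos d g) (pos e x) = gL (pos d f) (pos e x) + gL (pos d g) (pos e x) :=
      fun d e x f g h => gU_gL _ _ _ (hne _ _ _ _ h.symm) (hne _ _ _ _ h.symm)
    have r1 : ∀ e f, gL (pos b e) (pos a f) = 1 + gL (pos a f) (pos b e) :=
      fun e f => gL_swap _ _ (hne _ _ _ _ hba)
    have r2 : ∀ e f, gL (pos c e) (pos b f) = 1 + gL (pos b f) (pos c e) :=
      fun e f => gL_swap _ _ (hne _ _ _ _ hcb)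
    have r3 : ∀ e f, gL (pos a e) (pos c f) = 1 + gL (pos c f) (pos a e) :=
      fun e f => gL_swap _ _ (hne _ _ _ _ hac)
    simp only [s _ _ _ _ _ hab, s _ _ _ _ _ hac, s _ _ _ _ _ hbc, s _ _ _ _ _ hba, s _ _ _ _ _ hca, s _ _ _ _ _ hcb, r1, r2, r3]
    linear_combination key + h2 * (
      gL (pos a false) (pos b false) +
      gL (pos a false) (pos b true) +
      gL (pos a true) (pos b false) +
      gL (pos a true) (pos b true) +
      gL (pos b false) (pos c false) +
      gL (pos b false) (pos c true) +
      gL (pos b true) (pos c false) +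
      gL (pos b true) (pos c true) +
      gL (pos c false) (pos a false) +
      gL (pos c false) (pos a true) +
      gL (pos c true) (pos a false) +
      gL (pos c true) (pos a true))

end

section
open Topology Filter Set
set_option linter.unusedVariables false

theorem gBW (x1 x2 y1 y2 : ℝ) (hx : x1 < x2) (hy : y1 < y2) (h1 : x1 ≠ y1) (h2 : x1 ≠ y2)
    (h3 : x2 ≠ y1) (h4 : x2 ≠ y2) :
    ∃ W : ℤ, (gB y1 y2 x2 - gB y1 y2 x1) + (gB x1 x2 y1 - gB x1 x2 y2) = 2 * W ∧
      (W : ZMod 2) = (gB x1 x2 y1 : ZMod 2) + (gB x1 x2 y2 : ZMod 2) := by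
  refine ⟨gB y1 y2 x2 * gB x1 x2 y1 - gB y1 y2 x1 * gB x1 x2 y2, ?_, ?_⟩
  · unfold gB
    split_ifs <;> first | rfl | (exfalso; grind)
  · unfold gB
    split_ifs <;> first | rfl | (exfalso; grind)

theorem gBase.toInv {ι : Type*} [Fintype ι] [DecidableEq ι] {g g' : ℝ → ℂ} {τ : ι → Bool → ℝ}
    (H : gBase g g' τ) (pos : ι → Bool → ℕ)
    (hpos : ∀ c e d f, pos c e < pos d f ↔ τ c e < τ d f) :
    gInv Finset.univ (fun c e a => gU (pos a false) (pos a true) (pos c e))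
      (fun c _ => if gSig g' τ c = 1 then 1 else 0) := by
  have hz2 : (2 : ZMod 2) = 0 := rfl
  have hu : ∀ c e a, gU (pos a false) (pos a true) (pos c e) =
      ((gB (τ a false) (τ a true) (τ c e) : ℤ) : ZMod 2) := by
    intro c e a
    have h1 := hpos a false c e
    have h2 := hpos c e a true
    have h3 := hpos a true c e
    have h4 := H.hlt a
    unfold gU gB
    simp only [h1, h2, h3, hpos]
    split_ifs <;> first | rfl | (exfalso; clear hz2; grind)
  have hs : ∀ c, gSig g' τ c = 1 ∨ gSig g' τ c = -1 := fun c => gS_im _ (H.him c)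
  have hB0 : ∀ a e, gB (τ a false) (τ a true) (τ a e) = 0 := by
    intro a e; unfold gB; rw [if_neg]; cases e <;> simp
  have hne : ∀ c e d f, c ≠ d → τ c e ≠ τ d f := fun c e d f h h' => h (H.hinj _ _ _ _ h').1
  refine ⟨fun c _ => rfl, ?_, ?_⟩
  · intro a
    have key := congrArg (Int.cast : ℤ → ZMod 2) (H.rectE a)
    push_cast at key
    have : ∀ c, ((if c = a then 0 else (gSig g' τ c : ZMod 2) *
        ((gB (τ a false) (τ a true) (τ c false) : ZMod 2) - gB (τ a false) (τ a true) (τ c true)))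
        : ZMod 2) = gU (pos a false) (pos a true) (pos c false) +
        gU (pos a false) (pos a true) (pos c true) := by
      intro c
      rw [hu, hu]
      split_ifs with h
      · subst h; simp [hB0]
      · rcases hs c with h | h <;> rw [h] <;> push_cast
        · linear_combination (- (gB (τ a false) (τ a true) (τ c true) : ZMod 2)) * hz2
        · linear_combination (- (gB (τ a false) (τ a true) (τ c false) : ZMod 2)) * hz2
    rw [Finset.sum_congr rfl (fun c _ => this c)] at key
    rw [key]
    linear_combination (if gSig g' τ a = 1 then (1 : ZMod 2) else 0) * hz2
  · intro a b hab
    set hh : ι → ℤ := fun c => if gSig g' τ c = 1 then 1 else 0 with hhh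
    have hsh : ∀ c, gSig g' τ c = 2 * hh c - 1 := by
      intro c
      rcases hs c with h | h <;> simp [hhh, h]
    obtain ⟨W, hW, hW2⟩ := gBW (τ a false) (τ a true) (τ b false) (τ b true) (H.hlt a) (H.hlt b)
      (hne _ _ _ _ hab) (hne _ _ _ _ hab) (hne _ _ _ _ hab) (hne _ _ _ _ hab)
    have key := H.rectN a b hab
    have e : ∀ c, gSig g' τ c *
      ((2 * gB (τ a false) (τ a true) (τ c false) + if c = a then 1 else 0) *
       (2 * gB (τ b false) (τ b true) (τ c true) + if c = b then 1 else 0) -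
       (2 * gB (τ a false) (τ a true) (τ c true) + if c = a then 1 else 0) *
       (2 * gB (τ b false) (τ b true) (τ c false) + if c = b then 1 else 0)) =
      4 * (gSig g' τ c * (gB (τ a false) (τ a true) (τ c false) * gB (τ b false) (τ b true) (τ c true)
        - gB (τ a false) (τ a true) (τ c true) * gB (τ b false) (τ b true) (τ c false))) +
      (if c = a then (4 * hh a - 2) * (gB (τ b false) (τ b true) (τ a true) -
        gB (τ b false) (τ b true) (τ a false)) else 0) +
      (if c = b then (4 * hh b - 2) * (gB (τ a false) (τ a true) (τ b false) -
        gB (τ a false) (τ a true) (τ b true)) else 0) := by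
      intro c
      by_cases ha : c = a
      · subst ha
        simp only [if_true, if_neg hab, hB0, hsh]; ring
      · by_cases hb : c = b
        · subst hb
          simp only [if_true, if_neg ha, hB0, hsh]; ring
        · simp only [if_neg ha, if_neg hb]; ring
    rw [Finset.sum_congr rfl (fun c _ => e c), Finset.sum_add_distrib, Finset.sum_add_distrib,
      Finset.sum_ite_eq', Finset.sum_ite_eq', if_pos (Finset.mem_univ _),
      if_pos (Finset.mem_univ _), ← Finset.mul_sum] at key
    have key2 : ∑ c, (gSig g' τ c * (gB (τ a false) (τ a true) (τ c false) * gB (τ b false) (τ b true) (τ c true)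
        - gB (τ a false) (τ a true) (τ c true) * gB (τ b false) (τ b true) (τ c false))) +
      hh a * (gB (τ b false) (τ b true) (τ a true) - gB (τ b false) (τ b true) (τ a false)) +
      hh b * (gB (τ a false) (τ a true) (τ b false) - gB (τ a false) (τ a true) (τ b true)) - W
      = 0 := by
      have : (4 : ℤ) ≠ 0 := by norm_num
      apply mul_left_cancel₀ this
      linear_combination key + 2 * hW
    have key3 := congrArg (Int.cast : ℤ → ZMod 2) key2
    push_cast at key3
    have e3 : ∀ c, (gSig g' τ c : ZMod 2) * ((gB (τ a false) (τ a true) (τ c false) : ZMod 2) * gB (τ b false) (τ b true) (τ c true)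
        - gB (τ a false) (τ a true) (τ c true) * gB (τ b false) (τ b true) (τ c false)) =
        gU (pos a false) (pos a true) (pos c false) * gU (pos b false) (pos b true) (pos c true) +
        gU (pos a false) (pos a true) (pos c true) * gU (pos b false) (pos b true) (pos c false) := by
      intro c
      simp only [hu]
      rcases hs c with h | h <;> rw [h] <;> push_cast
      · linear_combination (- (gB (τ a false) (τ a true) (τ c true) : ZMod 2) *
          gB (τ b false) (τ b true) (τ c false)) * hz2
      · linear_combination (- (gB (τ a false) (τ a true) (τ c false) : ZMod 2) *
          gB (τ b false) (τ b true) (τ c true)) * hz2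
    rw [Finset.sum_congr rfl (fun c _ => e3 c), hW2] at key3
    have hc : ∀ c, ((hh c : ℤ) : ZMod 2) = if gSig g' τ c = 1 then 1 else 0 := by
      intro c; simp only [hhh]; split_ifs <;> simp
    rw [hc, hc] at key3
    rw [hu a false b, hu a true b, hu b false a, hu b true a]
    set X : ZMod 2 := if gSig g' τ a = 1 then 1 else 0
    set Y : ZMod 2 := if gSig g' τ b = 1 then 1 else 0
    linear_combination key3 + (X * (gB (τ b false) (τ b true) (τ a false) : ZMod 2) +
      Y * (gB (τ a false) (τ a true) (τ b true) : ZMod 2) +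
      (gB (τ a false) (τ a true) (τ b false) : ZMod 2) + 
      (gB (τ a false) (τ a true) (τ b true) : ZMod 2)) * hz2

end

section
open Topology Filter Set
set_option linter.unusedVariables false

def gSym {A B : Type} : Letter A B → A ⊕ B
  | .inl a => .inl a
  | .inr (P, _) => .inr P

theorem gSym_toggle {A B : Type} (x : Letter A B) : gSym (toggle x) = gSym x := by
  rcases x with a | ⟨P, b⟩ <;> rfl

theorem g_list {X : Type*} (α β γ : List X) (p q P Q : X) (k : ℕ) :
    (α ++ P :: β.reverse ++ Q :: γ)[gRho α.length (α.length + 1 + β.length) k]? =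
      if k = α.length then some P else if k = α.length + 1 + β.length then some Q else
        (α ++ p :: β ++ q :: γ)[k]? := by
  set x := α.length with hx
  set y := x + 1 + β.length with hy
  have L1 : ∀ (β : List X) (P Q : X) (k : ℕ), k < x → (α ++ P :: β ++ Q :: γ)[k]? = α[k]? := by
    intro β P Q k h
    rw [List.append_assoc, List.getElem?_append_left (by omega)]
  have L2 : ∀ (β' : List X) (P Q : X) (k : ℕ), k < β'.length →
      (α ++ P :: β' ++ Q :: γ)[x + 1 + k]? = β'[k]? := by
    intro β' P Q k h
    rw [List.append_assoc, List.getElem?_append_right (by omega),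
      show x + 1 + k - α.length = k + 1 by omega, List.cons_append, List.getElem?_cons_succ,
      List.getElem?_append_left h]
  have L3 : ∀ (β' : List X) (P Q : X) (k : ℕ), β'.length = β.length →
      (α ++ P :: β' ++ Q :: γ)[y + k]? = (Q :: γ)[k]? := by
    intro β' P Q k h
    rw [List.getElem?_append_right (by simp; omega)]
    congr 1
    simp; omega
  have L4 : ∀ (β' : List X) (P Q : X), (α ++ P :: β' ++ Q :: γ)[x]? = some P := by
    intro β' P Q
    rw [List.append_assoc, List.getElem?_append_right (by omega)]
    simp [hx]
  unfold gRho
  by_cases h1 : k = x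
  · subst h1
    rw [if_neg (by omega), if_pos rfl, L4]
  rw [if_neg h1]
  by_cases h2 : k = y
  · subst h2
    rw [if_neg (by omega), if_pos rfl, ← Nat.add_zero y, L3 _ _ _ _ (by simp)]
    rfl
  rw [if_neg h2]
  by_cases h3 : k < x
  · rw [if_neg (by omega), L1 _ _ _ _ h3, L1 _ _ _ _ h3]
  by_cases h4 : y < k
  · rw [if_neg (by omega)]
    obtain ⟨m, rfl⟩ : ∃ m, k = y + (m + 1) := ⟨k - y - 1, by omega⟩
    rw [L3 _ _ _ _ (by simp), L3 _ _ _ _ (by simp)]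
    rfl
  · rw [if_pos (by omega)]
    obtain ⟨m, rfl⟩ : ∃ m, k = x + 1 + m := ⟨k - x - 1, by omega⟩
    rw [L2 _ _ _ _ (by omega), show x + y - (x + 1 + m) = x + 1 + (β.length - 1 - m) by omega,
      L2 _ _ _ _ (by simp; omega), List.getElem?_reverse (by omega)]
    congr 1
    omega

structure gLI {A B : Type} {ι : Type*} [Fintype ι] [DecidableEq ι] (S : List (Letter A B))
    (lab : ι → A ⊕ B) (pos : ι → Bool → ℕ) (h : ι → Bool → ZMod 2) : Prop where
  lab_inj : Function.Injective lab
  pos_inj : ∀ c e d f, pos c e = pos d f → c = d ∧ e = f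
  get : ∀ c e, (S.map gSym)[pos c e]? = some (lab c)
  cover : ∀ k < S.length, ∃ c e, pos c e = k
  inv : gInv (Finset.univ.filter fun c => (lab c).isLeft = true)
    (fun c e a => gU (pos a false) (pos a true) (pos c e)) h

theorem gRho_symm (x y k : ℕ) : gRho x y k = gRho y x k := by
  unfold gRho; split_ifs <;> omega

theorem gU_symm (x y k : ℕ) : gU x y k = gU y x k := by
  unfold gU; split_ifs <;> first | rfl | omega

theorem gLI.ends {A B : Type} {ι : Type*} [Fintype ι] [DecidableEq ι] {S : List (Letter A B)}
    {lab : ι → A ⊕ B} {pos : ι → Bool → ℕ} {h : ι → Bool → ZMod 2} (I : gLI S lab pos h)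
    (x y : ℕ) (hxy : x ≠ y) (s : A ⊕ B) (hx : (S.map gSym)[x]? = some s)
    (hy : (S.map gSym)[y]? = some s) :
    ∃ c, lab c = s ∧ ((pos c false = x ∧ pos c true = y) ∨ (pos c false = y ∧ pos c true = x)) := by
  have lx : x < S.length := by
    by_contra hc; rw [List.getElem?_eq_none (by simp; omega)] at hx; cases hx
  have ly : y < S.length := by
    by_contra hc; rw [List.getElem?_eq_none (by simp; omega)] at hy; cases hy
  obtain ⟨c, e, he⟩ := I.cover x lx
  obtain ⟨d, f, hf⟩ := I.cover y ly
  have h1 := I.get c e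
  have h2 := I.get d f
  rw [he, hx] at h1
  rw [hf, hy] at h2
  have h1' := Option.some.inj h1
  have h2' := Option.some.inj h2
  have : d = c := I.lab_inj (h2'.symm.trans h1')
  subst this
  refine ⟨d, h2'.symm, ?_⟩
  cases e <;> cases f
  · omega
  · exact Or.inl ⟨he, hf⟩
  · exact Or.inr ⟨hf, he⟩
  · omega

theorem gLI.step {A B : Type} {ι : Type*} [Fintype ι] [DecidableEq ι] {S T : List (Letter A B)}
    {lab : ι → A ⊕ B} {pos : ι → Bool → ℕ} {h : ι → Bool → ZMod 2} (I : gLI S lab pos h)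
    (hST : SplitStep S T) :
    ∃ lab' pos', ∃ h' : ι → Bool → ZMod 2, gLI T lab' pos' h' := by
  obtain ⟨α, β, γ, p, P, hfresh, hS, hT⟩ := hST
  set x := α.length with hx
  set y := x + 1 + β.length with hy
  have lST : T.length = S.length := by rw [hS, hT]; simp
  have ly : y < S.length := by rw [hS]; simp; omega
  have mS : S.map gSym = α.map gSym ++ Sum.inl p :: β.map gSym ++ Sum.inl p :: γ.map gSym := by
    rw [hS]; simp [gSym]
  have mT : T.map gSym = α.map gSym ++ Sum.inr P :: (β.map gSym).reverse ++
      Sum.inr P :: γ.map gSym := by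
    rw [hT]
    have e : (gSym : Letter A B → A ⊕ B) ∘ toggle = gSym := funext gSym_toggle
    simp only [List.map_append, List.map_cons, List.map_map, e, List.map_reverse]
    rfl
  have key : ∀ k, (T.map gSym)[gRho x y k]? = if k = x then some (Sum.inr P) else if k = y then
      some (Sum.inr P) else (S.map gSym)[k]? := by
    intro k
    have := g_list (α.map gSym) (β.map gSym) (γ.map gSym) (Sum.inl p) (Sum.inl p) (Sum.inr P)
      (Sum.inr P : A ⊕ B) k
    rw [mT, mS]
    simp only [List.length_map] at this
    exact this
  have sx : (S.map gSym)[x]? = some (Sum.inl p) := by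
    rw [mS, List.append_assoc, List.getElem?_append_right (by simp; omega)]
    simp [hx]
  have sy : (S.map gSym)[y]? = some (Sum.inl p) := by
    rw [mS, List.getElem?_append_right (by simp; omega)]
    rw [List.getElem?_cons, if_pos (by simp; omega)]
  obtain ⟨c, hc, hxy⟩ := I.ends x y (by omega) _ sx sy
  have hrho : ∀ k, gRho x y k = gRho (pos c false) (pos c true) k := by
    intro k
    rcases hxy with ⟨h1, h2⟩ | ⟨h1, h2⟩ <;> rw [h1, h2]
    exact gRho_symm _ _ _
  have hPl : ∀ d, lab d ≠ Sum.inr P := by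
    intro d hd
    have h1 := I.get d false
    rw [hd] at h1
    have := List.mem_of_getElem? h1
    obtain ⟨l, hl, hl2⟩ := List.mem_map.mp this
    rcases l with a | ⟨Q, b⟩
    · simp [gSym] at hl2
    · simp [gSym] at hl2
      subst hl2
      exact hfresh b hl
  have hne : ∀ d e f, d ≠ c → pos d e ≠ pos c f := fun d e f h h' => h (I.pos_inj _ _ _ _ h').1
  have hpinj : ∀ a e d f, gRho (pos c false) (pos c true) (pos a e) =
      gRho (pos c false) (pos c true) (pos d f) → a = d ∧ e = f :=
    fun a e d f h => I.pos_inj _ _ _ _ (gRho_inj _ _ _ _ h)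
  have G := gGeo_pos pos I.pos_inj
  have G' := gGeo_pos (fun d e => gRho (pos c false) (pos c true) (pos d e)) hpinj
  have hcU : c ∈ Finset.univ.filter fun c => (lab c).isLeft = true := by simp [hc]
  have hr0 : gRho (pos c false) (pos c true) (pos c false) = pos c false := by
    unfold gRho; split_ifs <;> omega
  have hr1 : gRho (pos c false) (pos c true) (pos c true) = pos c true := by
    unfold gRho; split_ifs <;> omega
  have hcc : pos c false ≠ pos c true := fun h => by simpa using (I.pos_inj _ _ _ _ h).2
  have J := I.inv.step rfl G c hcU
    (fun d e a => gU (gRho (pos c false) (pos c true) (pos a false))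
      (gRho (pos c false) (pos c true) (pos a true)) (gRho (pos c false) (pos c true) (pos d e)))
    G'.self (by
      intro d e
      simp only [hr0, hr1, gU_rho]) (by
      intro d e a hda hac
      exact gU_refl _ _ _ _ _ hcc (hne _ _ _ hac) (hne _ _ _ hac) (hne _ _ _ hac) (hne _ _ _ hac)
        (fun h => hda (I.pos_inj _ _ _ _ h).1) (fun h => hda (I.pos_inj _ _ _ _ h).1))
  have hUe : (Finset.univ.filter fun d => (Function.update lab c (Sum.inr P) d).isLeft = true) =
      (Finset.univ.filter fun c => (lab c).isLeft = true).erase c := by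
    ext d
    by_cases hd : d = c
    · subst hd; simp
    · simp [hd]
  refine ⟨Function.update lab c (Sum.inr P), fun d e => gRho (pos c false) (pos c true) (pos d e),
    _, ?_, hpinj, ?_, ?_, hUe ▸ J⟩
  · intro d e hde
    by_cases hd : d = c <;> by_cases he : e = c
    · rw [hd, he]
    · subst hd; simp [he] at hde; exact absurd hde.symm (hPl _)
    · subst he; simp [hd] at hde; exact absurd hde (hPl _)
    · simp [hd, he] at hde; exact I.lab_inj hde
  · intro d e
    rw [← hrho, key]
    by_cases hd : d = c
    · subst hd
      rcases hxy with ⟨h1, h2⟩ | ⟨h1, h2⟩ <;> cases e <;> simp [h1, h2]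
    · have n0 := hne d e false hd
      have n1 := hne d e true hd
      rw [if_neg, if_neg, I.get]
      · simp [hd]
      · rcases hxy with ⟨h1, h2⟩ | ⟨h1, h2⟩ <;> omega
      · rcases hxy with ⟨h1, h2⟩ | ⟨h1, h2⟩ <;> omega
  · intro k hk
    have : gRho x y k < S.length := by
      unfold gRho; split_ifs <;> omega
    obtain ⟨d, e, he⟩ := I.cover _ this
    exact ⟨d, e, by rw [he, hrho, gRho_rho]⟩

theorem gLI.final {A B : Type} {ι : Type*} [Fintype ι] [DecidableEq ι] {T : List (Letter A B)}
    {lab : ι → A ⊕ B} {pos : ι → Bool → ℕ} {h : ι → Bool → ZMod 2} (I : gLI T lab pos h)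
    (hfull : ∀ l ∈ T, l.isRight = true) : (SimpleGraph.fromRel (CrossIn T)).Colorable 2 := by
  classical
  have hU : (Finset.univ.filter fun c => (lab c).isLeft = true) = ∅ := by
    rw [Finset.filter_eq_empty_iff]
    intro c _ hc
    have h1 := I.get c false
    have := List.mem_of_getElem? h1
    obtain ⟨l, hl, hl2⟩ := List.mem_map.mp this
    have := hfull l hl
    rw [← hl2] at hc
    rcases l with a | ⟨Q, b⟩
    · simp at this
    · simp [gSym] at hc
  have J := I.inv
  rw [hU] at J
  have G := gGeo_pos pos I.pos_inj
  have hh : ∀ c, h c true = h c false := by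
    intro c
    have := J.hE c
    simp only [Finset.sum_empty, zero_add] at this
    generalize h c true = X at *
    generalize h c false = Y at *
    revert X Y; decide
  let col : B → ZMod 2 := fun P => if hP : ∃ c, lab c = Sum.inr P then h hP.choose false else 0
  have hcol : ∀ c P, lab c = Sum.inr P → col P = h c false := by
    intro c P hc
    have hP : ∃ c, lab c = Sum.inr P := ⟨c, hc⟩
    simp only [col, dif_pos hP]
    rw [I.lab_inj (hP.choose_spec.trans hc.symm)]
  have occ : ∀ P i, occursAt T P i → (T.map gSym)[(i : ℕ)]? = some (Sum.inr P) := by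
    rintro P i ⟨b, hb⟩
    rw [List.getElem?_map, List.getElem?_eq_getElem i.2]
    have : T[(i : ℕ)] = Sum.inr (P, b) := hb
    rw [this]; rfl
  have main : ∀ P Q, P ≠ Q → CrossIn T P Q → col P ≠ col Q := by
    rintro P Q hPQ ⟨i, j, k, l, hij, hi, hj, hk, hl, hkl, hx⟩
    obtain ⟨c, hc, hcp⟩ := I.ends i j (by omega) _ (occ _ _ hi) (occ _ _ hj)
    obtain ⟨d, hd, hdp⟩ := I.ends k l (by omega) _ (occ _ _ hk) (occ _ _ hl)
    have hcd : c ≠ d := by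
      rintro rfl
      rw [hc] at hd; exact hPQ (Sum.inr.inj hd)
    rw [hcol c P hc, hcol d Q hd]
    have n := J.hN c d hcd
    have s := G.sym c d
    simp only [Finset.sum_empty, zero_add, hh] at n s
    have one : gU (pos c false) (pos c true) (pos d false) +
        gU (pos c false) (pos c true) (pos d true) = 1 := by
      have e0 : ∀ k, gU (pos c false) (pos c true) k = gU i j k := by
        intro k
        rcases hcp with ⟨h1, h2⟩ | ⟨h1, h2⟩ <;> rw [h1, h2]
        exact gU_symm _ _ _
      have e1 : gU i j k + gU i j l = 1 := by
        have hij' : (i : ℕ) < j := hij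
        have hx' : (((i : ℕ) < k ∧ (k : ℕ) < j) ∧ ¬ ((i : ℕ) < l ∧ (l : ℕ) < j)) ∨
          (((i : ℕ) < l ∧ (l : ℕ) < j) ∧ ¬ ((i : ℕ) < k ∧ (k : ℕ) < j)) := hx
        unfold gU
        split_ifs <;> first | rfl | omega
      rw [e0, e0]
      rcases hdp with ⟨h1, h2⟩ | ⟨h1, h2⟩ <;> rw [h1, h2]
      · exact e1
      · rw [add_comm]; exact e1
    have s' := s.symm.trans one
    intro hEq
    rw [hEq] at n
    rw [← mul_add, ← mul_add, s', one] at n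
    revert n
    generalize h d false = X
    revert X; decide
  have C : (SimpleGraph.fromRel (CrossIn T)).Coloring (ZMod 2) :=
    SimpleGraph.Coloring.mk col (by
      intro P Q hPQ
      rw [SimpleGraph.fromRel_adj] at hPQ
      obtain ⟨hne, h1 | h1⟩ := hPQ
      · exact main _ _ hne h1
      · exact (main _ _ hne.symm h1).symm)
  have := C.colorable
  simpa using this

end

section
open Topology Filter Set

theorem g_card2 {m : ℕ} (s : Finset (Fin m)) (h : s.card = 2) :
    ∃ f : Bool → Fin m, f false < f true ∧ ∀ k, k ∈ s ↔ ∃ e, k = f e := by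
  obtain ⟨i, j, hij, rfl⟩ := Finset.card_eq_two.mp h
  rcases lt_or_gt_of_ne hij with h | h
  · exact ⟨fun e => if e then j else i, by simpa using h, fun k => by simp⟩
  · exact ⟨fun e => if e then i else j, by simpa using h, fun k => by simp [or_comm]⟩

theorem g_imne (x y : ℝ × ℝ) (h : LinearIndependent ℝ ![x, y]) (hy : y ≠ 0) :
    (Complex.equivRealProdCLM.symm x / Complex.equivRealProdCLM.symm y).im ≠ 0 := by
  intro h0
  set z := Complex.equivRealProdCLM.symm x with hz
  set w := Complex.equivRealProdCLM.symm y with hw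
  have hw0 : w ≠ 0 := by
    intro h; apply hy
    have := congrArg Complex.equivRealProdCLM h
    rw [hw, ContinuousLinearEquiv.apply_symm_apply, map_zero] at this
    exact this
  have e : z = ((z / w).re : ℂ) * w := by
    have : z / w = ((z / w).re : ℂ) := by
      apply Complex.ext <;> simp [h0]
    rw [← this, div_mul_cancel₀ _ hw0]
  rw [LinearIndependent.pair_iff] at h
  have := (h 1 (-(z / w).re) (by
    apply Complex.equivRealProdCLM.symm.injective
    rw [map_add, map_smul, map_smul, ← hz, ← hw, map_zero, one_smul]
    rw [neg_smul, Complex.real_smul, ← e]; simp)).1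
  exact one_ne_zero this

end

/-- If a crossing sequence `w` of length `2n` is realizable as the Gauss code of a
closed plane curve, then the interlacement graph of any fully split sequence `T = S*`
obtained from it (chords given by the split pairs, interlacement taken in the cyclic
word `S*`) is bipartite. -/
theorem stmt16 {n : ℕ} {A B : Type} [DecidableEq A]
    (γ : ℝ → ℝ × ℝ)
    (hper : ∀ s : ℝ, γ (s + 1) = γ s)
    (hsmooth : ContDiff ℝ 1 γ)
    (himm : ∀ s : ℝ, deriv γ s ≠ 0)
    (t : Fin (2 * n) → ℝ) (ht : StrictMono t)
    (htrange : ∀ i, t i ∈ Set.Ico (0 : ℝ) 1)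
    (w : Fin (2 * n) → A)
    (hw : ∀ a : A, a ∈ Set.range w →
      (Finset.univ.filter fun i => w i = a).card = 2)
    (hcross : ∀ s u : ℝ, s ∈ Set.Ico (0 : ℝ) 1 → u ∈ Set.Ico (0 : ℝ) 1 → s ≠ u →
      (γ s = γ u ↔ ∃ i j : Fin (2 * n), i ≠ j ∧ s = t i ∧ u = t j ∧ w i = w j))
    (htrans : ∀ i j : Fin (2 * n), i ≠ j → w i = w j →
      LinearIndependent ℝ ![deriv γ (t i), deriv γ (t j)])
    (T : List (Letter A B))
    (hsplit : Relation.ReflTransGen SplitStep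
      ((List.ofFn w).map Sum.inl) T)
    (hfull : ∀ l ∈ T, l.isRight = true) :
    (SimpleGraph.fromRel (CrossIn T)).Colorable 2 := by
  classical
  let ι := {a : A // a ∈ Set.range w}
  have : Fintype ι := Fintype.ofFinite ι
  have hc := fun c : ι => g_card2 _ (hw c.1 c.2)
  choose ps hps hps2 using hc
  have hwp : ∀ c e, w (ps c e) = c.1 := by
    intro c e
    have := (hps2 c (ps c e)).2 ⟨e, rfl⟩
    simpa using this
  have hpi : ∀ c e d f, ps c e = ps d f → c = d ∧ e = f := by
    intro c e d f h
    have h1 : c = d := Subtype.ext (by rw [← hwp c e, h, hwp])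
    subst h1
    refine ⟨rfl, ?_⟩
    have := hps c
    cases e <;> cases f
    · rfl
    · rw [h] at this; exact absurd this (lt_irrefl _)
    · rw [h] at this; exact absurd this (lt_irrefl _)
    · rfl
  have hne : ∀ c : ι, ps c false ≠ ps c true := fun c => (hps c).ne
  let L := Complex.equivRealProdCLM.symm
  have H : gBase (fun s => L (γ s)) (fun s => L (deriv γ s)) (fun (c : ι) e => t (ps c e)) := by
    refine ⟨?_, ?_, ?_, ?_, ?_, ?_, ?_, ?_, ?_, ?_⟩
    · intro x
      have h1 : HasStrictDerivAt γ (deriv γ x) x :=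
        hsmooth.contDiffAt.hasStrictDerivAt one_ne_zero
      exact (L : ℝ × ℝ →L[ℝ] ℂ).hasStrictFDerivAt.comp_hasStrictDerivAt x h1
    · intro x; simp only [hper]
    · intro x
      have : deriv γ (x + 1) = deriv γ x := by
        rw [← deriv_comp_add_const]
        congr 1
        funext s
        exact hper s
      simp only [this]
    · intro x h
      exact himm x (L.injective (by simpa using h))
    · intro c e d f h
      exact hpi _ _ _ _ (ht.injective h)
    · intro c; exact ht (hps c)
    · intro c e; exact htrange _
    · intro s hs u hu hsu hg
      obtain ⟨i, j, hij, rfl, rfl, hwij⟩ := (hcross s u hs hu hsu).1 (L.injective hg)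
      let c : ι := ⟨w i, i, rfl⟩
      obtain ⟨e, he⟩ := (hps2 c i).1 (by simp [c])
      obtain ⟨f, hf⟩ := (hps2 c j).1 (by simp [c, hwij])
      refine ⟨c, e, by rw [← he], ?_⟩
      have : f = !e := by
        cases e <;> cases f <;> first | rfl | (exact absurd (he.trans hf.symm) hij)
      rw [hf, this]
    · intro c
      have := (hcross (t (ps c false)) (t (ps c true)) (htrange _) (htrange _)
        (ht (hps c)).ne).2 ⟨_, _, hne c, rfl, rfl, by rw [hwp, hwp]⟩
      simp only [this]
    · intro c
      exact g_imne _ _ (htrans _ _ (hne c) (by rw [hwp, hwp])) (himm _)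
  have J := H.toInv (fun c e => (ps c e : ℕ)) (by
    intro c e d f
    rw [ht.lt_iff_lt]; rfl)
  have base : ∃ lab : ι → A ⊕ B, ∃ pos, ∃ h : ι → Bool → ZMod 2,
      gLI ((List.ofFn w).map Sum.inl : List (Letter A B)) lab pos h := by
    refine ⟨fun c => Sum.inl c.1, fun c e => (ps c e : ℕ), fun c _ =>
      if gSig (fun s => L (deriv γ s)) (fun (c : ι) e => t (ps c e)) c = 1 then 1 else 0, ?_, ?_, ?_, ?_, ?_⟩
    rotate_left 4
    · simpa using J
    · intro c d h; exact Subtype.ext (Sum.inl.inj h)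
    · intro c e d f h; exact hpi _ _ _ _ (Fin.ext h)
    · intro c e
      simp [List.getElem?_ofFn, hwp, gSym]
    · intro k hk
      simp at hk
      obtain ⟨e, he⟩ := (hps2 ⟨w ⟨k, hk⟩, _, rfl⟩ ⟨k, hk⟩).1 (by simp)
      exact ⟨_, e, by rw [← he]⟩
  have all : ∃ lab : ι → A ⊕ B, ∃ pos, ∃ h : ι → Bool → ZMod 2, gLI T lab pos h := by
    clear hfull
    induction hsplit with
    | refl => exact base
    | tail _ h2 ih =>
      obtain ⟨lab, pos, h, I⟩ := ih
      exact I.step h2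
  obtain ⟨lab, pos, h, I⟩ := all
  exact I.final hfull
end
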